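/- Fix n ≥ 1 and k with 1 ≤ k ≤ 1+n, and let T be a natural 2-covariant tensor associated to a Lorentzian metric and a k-form on open subsets of ℝ^{1+n}. If T satisfies: (1) independence of the unit of scale, i.e. T(λ²g, λ^{k−1}ω) = T(g,ω) for every λ > 0; (2) for every point x, ω_x = 0 implies T(g,ω)_x = 0; and (3) div_g T(g,ω) = 0 whenever dω = 0 and ∂_g ω = 0; then there is a constant μ ∈ ℝ (independent of g and ω) such that T(g,ω) = μ · E(g,ω), where E(g,ω) := (−1)^{k−1}( ⟨i_−ω, i_−ω⟩_g − (1/2) ⟨ω,ω⟩_g g ) is the energy tensor. -/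

import Mathlib

namespace Paper

noncomputable section

/-- Points of `ℝ^{1+n}`. -/
abbrev Pt (n : ℕ) := Fin (n + 1) → ℝ

/-- Partial derivative `∂_a f` of a scalar function. -/
def pd (n : ℕ) (a : Fin (n + 1)) (f : Pt n → ℝ) (x : Pt n) : ℝ :=
  fderiv ℝ f x (Pi.single a 1)

/-- The signs `ε₀ = 1`, `ε_i = -1` for `i ≠ 0`. -/
def eps (n : ℕ) (i : Fin (n + 1)) : ℝ := if i = 0 then 1 else -1

/-- The standard Minkowski matrix `diag(1, -1, …, -1)`. -/
def minkM (n : ℕ) (a b : Fin (n + 1)) : ℝ := if a = b then eps n a else 0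

/-- Prepend an entry to an index tuple: `(a, v₁, …, v_{k-1})`. -/
def dcons {α : Type*} (k : ℕ) (a : α) (v : Fin (k - 1) → α) : Fin k → α :=
  fun j => if h : (j : ℕ) = 0 then a else v ⟨(j : ℕ) - 1, by have := j.isLt; omega⟩

/-- Append an entry to an index tuple: `(v₁, …, v_{k-1}, b)`. -/
def dsnoc {α : Type*} (k : ℕ) (v : Fin (k - 1) → α) (b : α) : Fin k → α :=
  fun j => if h : (j : ℕ) < k - 1 then v ⟨(j : ℕ), h⟩ else b

/-- `g` (given by its components) is a Lorentzian metric on the open set `W`: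
it is smooth on `W` and, at each point of `W`, a symmetric bilinear form of
signature `(1,n)` (i.e. congruent to the Minkowski matrix). -/
def IsMetricOn (n : ℕ) (W : Set (Pt n)) (g : Pt n → Fin (n + 1) → Fin (n + 1) → ℝ) : Prop :=
  (∀ a b, ContDiffOn ℝ (⊤ : ℕ∞) (fun x => g x a b) W) ∧
  (∀ x ∈ W, (∀ a b, g x a b = g x b a) ∧
    ∃ P : Matrix (Fin (n + 1)) (Fin (n + 1)) ℝ, IsUnit P.det ∧
      ∀ a b, (∑ c, ∑ d, P c a * g x c d * P d b) = minkM n a b)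

/-- `ω` (given by its components) is a smooth `k`-form field on the open set `W`. -/
def IsFormOn (n k : ℕ) (W : Set (Pt n)) (ω : Pt n → (Fin k → Fin (n + 1)) → ℝ) : Prop :=
  (∀ v, ContDiffOn ℝ (⊤ : ℕ∞) (fun x => ω x v) W) ∧
  (∀ x ∈ W, ∀ (v : Fin k → Fin (n + 1)) (σ : Equiv.Perm (Fin k)),
    ω x (v ∘ σ) = ((Equiv.Perm.sign σ : ℤ) : ℝ) * ω x v)

/-- `t` is a smooth 2-covariant tensor field on `W`. -/
def IsTensorFieldOn (n : ℕ) (W : Set (Pt n)) (t : Pt n → Fin (n + 1) → Fin (n + 1) → ℝ) : Prop :=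
  ∀ a b, ContDiffOn ℝ (⊤ : ℕ∞) (fun x => t x a b) W

/-- `τ : W → W'` is a diffeomorphism between open subsets of `ℝ^{1+n}`, with inverse `σf`. -/
structure IsDiffeoOn (n : ℕ) (τ σf : Pt n → Pt n) (W W' : Set (Pt n)) : Prop where
  open_src : IsOpen W
  open_tgt : IsOpen W'
  mapsTo : Set.MapsTo τ W W'
  mapsTo_inv : Set.MapsTo σf W' W
  left_inv : ∀ x ∈ W, σf (τ x) = x
  right_inv : ∀ y ∈ W', τ (σf y) = y
  smooth : ContDiffOn ℝ (⊤ : ℕ∞) τ W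
  smooth_inv : ContDiffOn ℝ (⊤ : ℕ∞) σf W'

/-- The Jacobian matrix `(dτ_x)(e_a)_c` of a map `τ`. -/
def jac (n : ℕ) (τ : Pt n → Pt n) (x : Pt n) (a c : Fin (n + 1)) : ℝ :=
  fderiv ℝ τ x (Pi.single a 1) c

/-- Pullback of a 2-covariant tensor field (in particular of a metric):
`(τ*g)_x(u,v) = g_{τ(x)}(dτ_x u, dτ_x v)`, componentwise. -/
def pullTensor (n : ℕ) (τ : Pt n → Pt n) (g : Pt n → Fin (n + 1) → Fin (n + 1) → ℝ) :
    Pt n → Fin (n + 1) → Fin (n + 1) → ℝ :=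
  fun x a b => ∑ c, ∑ d, jac n τ x a c * jac n τ x b d * g (τ x) c d

/-- Pullback of a `k`-form field, componentwise. -/
def pullForm (n k : ℕ) (τ : Pt n → Pt n) (ω : Pt n → (Fin k → Fin (n + 1)) → ℝ) :
    Pt n → (Fin k → Fin (n + 1)) → ℝ :=
  fun x v => ∑ w : Fin k → Fin (n + 1), (∏ j, jac n τ x (v j) (w j)) * ω (τ x) w

/-- A natural 2-covariant tensor `T(g,ω)` associated to a Lorentzian metric and a `k`-form
on open subsets of `ℝ^{1+n}`: a rule assigning to every open `W` and every pair `(g,ω)` on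
`W` a 2-covariant tensor field `T(g,ω)` on `W` that commutes with restrictions, is
equivariant under diffeomorphisms between open subsets, and is regular (smooth families of
data yield smooth families of values). -/
structure NaturalTensor (n k : ℕ) where
  T : Set (Pt n) → (Pt n → Fin (n + 1) → Fin (n + 1) → ℝ) →
      (Pt n → (Fin k → Fin (n + 1)) → ℝ) → (Pt n → Fin (n + 1) → Fin (n + 1) → ℝ)
  smooth : ∀ W g ω, IsOpen W → IsMetricOn n W g → IsFormOn n k W ω →
      IsTensorFieldOn n W (T W g ω)
  localize : ∀ W₁ W₂ g₁ ω₁ g₂ ω₂, IsOpen W₁ → IsOpen W₂ → W₁ ⊆ W₂ →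
      IsMetricOn n W₁ g₁ → IsFormOn n k W₁ ω₁ →
      IsMetricOn n W₂ g₂ → IsFormOn n k W₂ ω₂ →
      (∀ x ∈ W₁, g₁ x = g₂ x ∧ ω₁ x = ω₂ x) →
      ∀ x ∈ W₁, T W₁ g₁ ω₁ x = T W₂ g₂ ω₂ x
  natural : ∀ τ σf W W', IsDiffeoOn n τ σf W W' →
      ∀ g ω, IsMetricOn n W' g → IsFormOn n k W' ω →
      ∀ x ∈ W, ∀ a b, T W (pullTensor n τ g) (pullForm n k τ ω) x a b =
        pullTensor n τ (T W' g ω) x a b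
  regular : ∀ (m : ℕ) (P : Set (Fin m → ℝ)) (W : Set (Pt n)), IsOpen P → IsOpen W →
      ∀ (g : (Fin m → ℝ) → Pt n → Fin (n + 1) → Fin (n + 1) → ℝ)
        (ω : (Fin m → ℝ) → Pt n → (Fin k → Fin (n + 1)) → ℝ),
      (∀ a b, ContDiffOn ℝ (⊤ : ℕ∞)
        (fun p : (Fin m → ℝ) × Pt n => g p.1 p.2 a b) (P ×ˢ W)) →
      (∀ v, ContDiffOn ℝ (⊤ : ℕ∞)
        (fun p : (Fin m → ℝ) × Pt n => ω p.1 p.2 v) (P ×ˢ W)) →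
      (∀ s ∈ P, IsMetricOn n W (g s) ∧ IsFormOn n k W (ω s)) →
      ∀ a b, ContDiffOn ℝ (⊤ : ℕ∞)
        (fun p : (Fin m → ℝ) × Pt n => T W (g p.1) (ω p.1) p.2 a b) (P ×ˢ W)

/-- The inverse metric `g^{ab}` at a point. -/
def ginv (n : ℕ) (g : Pt n → Fin (n + 1) → Fin (n + 1) → ℝ) (x : Pt n) :
    Matrix (Fin (n + 1)) (Fin (n + 1)) ℝ :=
  (Matrix.of fun a b => g x a b)⁻¹

/-- The Christoffel symbols
`Γ^c_{ab} = (1/2) g^{cd}(∂_a g_{db} + ∂_b g_{da} − ∂_d g_{ab})`. -/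
def christoffel (n : ℕ) (g : Pt n → Fin (n + 1) → Fin (n + 1) → ℝ) (x : Pt n)
    (c a b : Fin (n + 1)) : ℝ :=
  (1 / 2) * ∑ d, ginv n g x c d *
    (pd n a (fun y => g y d b) x + pd n b (fun y => g y d a) x - pd n d (fun y => g y a b) x)

/-- The divergence of a 2-covariant tensor field: `(div_g t)_b = g^{ac} ∇_a t_{cb}`. -/
def divT (n : ℕ) (g t : Pt n → Fin (n + 1) → Fin (n + 1) → ℝ) (x : Pt n)
    (b : Fin (n + 1)) : ℝ :=
  ∑ a, ∑ c, ginv n g x a c *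
    (pd n a (fun y => t y c b) x - (∑ e, christoffel n g x e a c * t x e b)
      - (∑ e, christoffel n g x e a b * t x c e))

/-- The covariant derivative `∇_a ω_{v₁…v_k}` of a `k`-form field. -/
def covd (n k : ℕ) (g : Pt n → Fin (n + 1) → Fin (n + 1) → ℝ)
    (ω : Pt n → (Fin k → Fin (n + 1)) → ℝ) (x : Pt n) (a : Fin (n + 1))
    (v : Fin k → Fin (n + 1)) : ℝ :=
  pd n a (fun y => ω y v) x -
    ∑ l : Fin k, ∑ e, christoffel n g x e a (v l) * ω x (Function.update v l e)

/-- The codifferential `(∂_g ω)_{i₁…i_{k−1}} = −g^{ab} ∇_a ω_{b i₁…i_{k−1}}`. -/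
def codiff (n k : ℕ) (g : Pt n → Fin (n + 1) → Fin (n + 1) → ℝ)
    (ω : Pt n → (Fin k → Fin (n + 1)) → ℝ) (x : Pt n)
    (v : Fin (k - 1) → Fin (n + 1)) : ℝ :=
  -∑ a, ∑ b, ginv n g x a b * covd n k g ω x a (dcons k b v)

/-- The exterior differential `(dω)_{i₀…i_k} = Σ_j (−1)^j ∂_{i_j} ω_{i₀…î_j…i_k}`. -/
def dext (n k : ℕ) (ω : Pt n → (Fin k → Fin (n + 1)) → ℝ) (x : Pt n)
    (u : Fin (k + 1) → Fin (n + 1)) : ℝ :=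
  ∑ j : Fin (k + 1), (-1 : ℝ) ^ (j : ℕ) * pd n (u j) (fun y => ω y (u ∘ j.succAbove)) x

/-- `(i_{∂_g ω} ω)_b = (1/(k−1)!) (∂_g ω)^{i₂…i_k} ω_{i₂…i_k b}`, indices raised with `g`. -/
def iCodiff (n k : ℕ) (g : Pt n → Fin (n + 1) → Fin (n + 1) → ℝ)
    (ω : Pt n → (Fin k → Fin (n + 1)) → ℝ) (x : Pt n) (b : Fin (n + 1)) : ℝ :=
  (1 / ((k - 1).factorial : ℝ)) *
    ∑ v : Fin (k - 1) → Fin (n + 1), ∑ w : Fin (k - 1) → Fin (n + 1),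
      (∏ j, ginv n g x (v j) (w j)) * codiff n k g ω x v * ω x (dsnoc k w b)

/-- The scalar product `⟨ω,ω⟩_g = (1/k!) ω^{i₁…i_k} ω_{i₁…i_k}`, indices raised with `g`. -/
def scalarSq (n k : ℕ) (g : Pt n → Fin (n + 1) → Fin (n + 1) → ℝ)
    (ω : Pt n → (Fin k → Fin (n + 1)) → ℝ) (x : Pt n) : ℝ :=
  (1 / (k.factorial : ℝ)) * ∑ v : Fin k → Fin (n + 1), ∑ w : Fin k → Fin (n + 1),
    (∏ j, ginv n g x (v j) (w j)) * ω x v * ω x w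

/-- The components of the 2-covariant tensor `⟨i_−ω, i_−ω⟩_g`:
`(1/(k−1)!) ω_a{}^{i₂…i_k} ω_{b i₂…i_k}`, indices raised with `g`. -/
def iiInner (n k : ℕ) (g : Pt n → Fin (n + 1) → Fin (n + 1) → ℝ)
    (ω : Pt n → (Fin k → Fin (n + 1)) → ℝ) (x : Pt n) (a b : Fin (n + 1)) : ℝ :=
  (1 / ((k - 1).factorial : ℝ)) *
    ∑ v : Fin (k - 1) → Fin (n + 1), ∑ w : Fin (k - 1) → Fin (n + 1),
      (∏ j, ginv n g x (v j) (w j)) * ω x (dcons k a v) * ω x (dcons k b w)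

/-- The energy tensor `E(g,ω) = (−1)^{k−1}(⟨i_−ω,i_−ω⟩_g − (1/2)⟨ω,ω⟩_g g)`. -/
def energyTensor (n k : ℕ) (g : Pt n → Fin (n + 1) → Fin (n + 1) → ℝ)
    (ω : Pt n → (Fin k → Fin (n + 1)) → ℝ) (x : Pt n) (a b : Fin (n + 1)) : ℝ :=
  (-1 : ℝ) ^ (k - 1) *
    (iiInner n k g ω x a b - (1 / 2) * scalarSq n k g ω x * g x a b)

/-- The Ricci tensor
`Ricci_{ab} = ∂_c Γ^c_{ab} − ∂_a Γ^c_{cb} + Γ^c_{cd} Γ^d_{ab} − Γ^c_{ad} Γ^d_{cb}`. -/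
def ricci (n : ℕ) (g : Pt n → Fin (n + 1) → Fin (n + 1) → ℝ) (x : Pt n)
    (a b : Fin (n + 1)) : ℝ :=
  (∑ c, pd n c (fun y => christoffel n g y c a b) x)
  - (∑ c, pd n a (fun y => christoffel n g y c c b) x)
  + (∑ c, ∑ d, christoffel n g x c c d * christoffel n g x d a b)
  - (∑ c, ∑ d, christoffel n g x c a d * christoffel n g x d c b)

/-- The scalar curvature `r(g) = g^{ab} Ricci_{ab}`. -/
def scalarCurv (n : ℕ) (g : Pt n → Fin (n + 1) → Fin (n + 1) → ℝ) (x : Pt n) : ℝ :=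
  ∑ a, ∑ b, ginv n g x a b * ricci n g x a b

end

end Paper

namespace Paper

open scoped Matrix

section Algebra

variable {ι : Type*} [Fintype ι] {k : ℕ}

/-- Action of a matrix on the components of a `k`-linear form. -/
noncomputable def pullF (P : Matrix ι ι ℝ) (w : (Fin k → ι) → ℝ) : (Fin k → ι) → ℝ :=
  fun v => ∑ u : Fin k → ι, (∏ j, P (v j) (u j)) * w u

/-- Alternating arrays of components. -/
def IsAlt {ι : Type*} {k : ℕ} (w : (Fin k → ι) → ℝ) : Prop :=
  ∀ (v : Fin k → ι) (σ : Equiv.Perm (Fin k)),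
    w (v ∘ σ) = ((Equiv.Perm.sign σ : ℤ) : ℝ) * w v

theorem IsAlt.add {ι : Type*} {k : ℕ} {w w' : (Fin k → ι) → ℝ} (h : IsAlt w) (h' : IsAlt w') :
    IsAlt (w + w') := by
  intro v σ
  simp only [Pi.add_apply, h v σ, h' v σ]; ring

theorem IsAlt.smul {ι : Type*} {k : ℕ} {w : (Fin k → ι) → ℝ} (h : IsAlt w) (c : ℝ) :
    IsAlt (c • w) := by
  intro v σ
  simp only [Pi.smul_apply, h v σ, smul_eq_mul]; ring

theorem IsAlt.pullF {w : (Fin k → ι) → ℝ} (h : IsAlt w) (P : Matrix ι ι ℝ) :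
    IsAlt (pullF P w) := by
  intro v σ
  simp only [Paper.pullF]
  rw [Finset.mul_sum, ← (Equiv.arrowCongr σ.symm (Equiv.refl ι)).sum_comp]
  refine Finset.sum_congr rfl fun u _ => ?_
  have : (Equiv.arrowCongr σ.symm (Equiv.refl ι)) u = u ∘ σ := by
    ext j; simp
  rw [this, h u σ]
  have : ∏ j, P ((v ∘ σ) j) ((u ∘ σ) j) = ∏ j, P (v j) (u j) :=
    Equiv.prod_comp σ (fun j => P (v j) (u j))
  rw [this]; ring

theorem pullF_add (P : Matrix ι ι ℝ) (w w' : (Fin k → ι) → ℝ) :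
    pullF P (w + w') = pullF P w + pullF P w' := by
  ext v; simp [pullF, mul_add, Finset.sum_add_distrib]

/-- Contraction of all slots of two arrays. -/
noncomputable def contr (G : Matrix ι ι ℝ) (φ ψ : (Fin k → ι) → ℝ) : ℝ :=
  ∑ v : Fin k → ι, ∑ w : Fin k → ι, (∏ j, G (v j) (w j)) * φ v * ψ w

theorem prod_mul_apply (P G : Matrix ι ι ℝ) (u w : Fin k → ι) :
    ∑ v : Fin k → ι, (∏ j, P (u j) (v j)) * (∏ j, G (v j) (w j)) =
      ∏ j, (P * G) (u j) (w j) := by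
  simp only [Matrix.mul_apply]
  rw [Finset.prod_univ_sum, Fintype.piFinset_univ]
  exact Finset.sum_congr rfl fun v _ => Finset.prod_mul_distrib.symm

theorem contr_pullF_left (G P : Matrix ι ι ℝ) (φ ψ : (Fin k → ι) → ℝ) :
    contr G (pullF P φ) ψ = contr (Pᵀ * G) φ ψ := by
  unfold contr
  simp_rw [← prod_mul_apply, pullF, Finset.mul_sum, Finset.sum_mul]
  rw [Finset.sum_comm]
  conv_rhs => rw [Finset.sum_comm]
  refine Finset.sum_congr rfl fun w _ => ?_
  rw [Finset.sum_comm]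
  refine Finset.sum_congr rfl fun u _ => Finset.sum_congr rfl fun v _ => ?_
  simp only [Matrix.transpose_apply]; ring

theorem contr_pullF_right (G P : Matrix ι ι ℝ) (φ ψ : (Fin k → ι) → ℝ) :
    contr G φ (pullF P ψ) = contr (G * P) φ ψ := by
  unfold contr
  simp_rw [← prod_mul_apply, pullF, Finset.mul_sum, Finset.sum_mul]
  refine Finset.sum_congr rfl fun v _ => ?_
  rw [Finset.sum_comm]
  refine Finset.sum_congr rfl fun u _ => Finset.sum_congr rfl fun w _ => ?_
  ring

theorem contr_pullF (G P : Matrix ι ι ℝ) (φ ψ : (Fin k → ι) → ℝ) :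
    contr G (pullF P φ) (pullF P ψ) = contr (Pᵀ * G * P) φ ψ := by
  rw [contr_pullF_left, contr_pullF_right]

theorem contr_sum_left {α : Type*} (s : Finset α) (G : Matrix ι ι ℝ)
    (c : α → ℝ) (φ : α → (Fin k → ι) → ℝ) (ψ : (Fin k → ι) → ℝ) :
    contr G (fun v => ∑ i ∈ s, c i * φ i v) ψ = ∑ i ∈ s, c i * contr G (φ i) ψ := by
  unfold contr
  simp_rw [Finset.mul_sum, Finset.sum_mul]
  conv_rhs => rw [Finset.sum_comm]
  refine Finset.sum_congr rfl fun v _ => ?_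
  conv_rhs => rw [Finset.sum_comm]
  exact Finset.sum_congr rfl fun w _ => Finset.sum_congr rfl fun i _ => by ring

theorem contr_sum_right {α : Type*} (s : Finset α) (G : Matrix ι ι ℝ)
    (c : α → ℝ) (φ : (Fin k → ι) → ℝ) (ψ : α → (Fin k → ι) → ℝ) :
    contr G φ (fun v => ∑ i ∈ s, c i * ψ i v) = ∑ i ∈ s, c i * contr G φ (ψ i) := by
  unfold contr
  simp_rw [Finset.mul_sum]
  conv_rhs => rw [Finset.sum_comm]
  refine Finset.sum_congr rfl fun v _ => ?_
  conv_rhs => rw [Finset.sum_comm]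
  exact Finset.sum_congr rfl fun w _ => Finset.sum_congr rfl fun i _ => by ring

theorem pullF_cons (P : Matrix ι ι ℝ) (w : (Fin (k + 1) → ι) → ℝ) (a : ι) (v : Fin k → ι) :
    pullF P w (Fin.cons a v) = ∑ c, P a c * pullF P (fun u => w (Fin.cons c u)) v := by
  unfold pullF
  rw [← (Fin.consEquiv (fun _ => ι)).sum_comp, Fintype.sum_prod_type]
  refine Finset.sum_congr rfl fun c _ => ?_
  rw [Finset.mul_sum]
  refine Finset.sum_congr rfl fun u _ => ?_
  simp [Fin.consEquiv, Fin.prod_univ_succ, mul_assoc]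

end Algebra

theorem dcons_succ {α : Type*} (k : ℕ) (a : α) (v : Fin k → α) :
    dcons (k + 1) a v = Fin.cons a v := by
  ext j
  refine Fin.cases ?_ (fun i => ?_) j
  · simp [dcons]
  · simp [dcons]

/-- The energy tensor at a point, as a function of the values of the metric and the form. -/
noncomputable abbrev en (n k : ℕ) (G : Matrix (Fin (n + 1)) (Fin (n + 1)) ℝ) (w : (Fin k → Fin (n + 1)) → ℝ)
    (a b : Fin (n + 1)) : ℝ :=
  energyTensor n k (fun _ => G) (fun _ => w) 0 a b

theorem en_eq (n k : ℕ) (G : Matrix (Fin (n + 1)) (Fin (n + 1)) ℝ)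
    (w : (Fin (k + 1) → Fin (n + 1)) → ℝ) (a b : Fin (n + 1)) :
    en n (k + 1) G w a b = (-1) ^ k * (1 / (k.factorial : ℝ) *
      contr G⁻¹ (fun v => w (Fin.cons a v)) (fun v => w (Fin.cons b v))
      - 1 / 2 * (1 / ((k + 1).factorial : ℝ) * contr G⁻¹ w w) * G a b) := by
  simp only [en, energyTensor, iiInner, scalarSq, contr, ginv]
  simp only [dcons_succ]
  rfl

theorem conj_apply {ι : Type*} [Fintype ι] (J G : Matrix ι ι ℝ) (a b : ι) :
    (J * G * Jᵀ) a b = ∑ c, ∑ d, J a c * J b d * G c d := by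
  simp only [Matrix.mul_apply, Matrix.transpose_apply, Finset.sum_mul]
  rw [Finset.sum_comm]
  exact Finset.sum_congr rfl fun c _ => Finset.sum_congr rfl fun d _ => by ring

theorem en_pull (n k : ℕ) (J G : Matrix (Fin (n + 1)) (Fin (n + 1)) ℝ) (hJ : IsUnit J.det)
    (w : (Fin (k + 1) → Fin (n + 1)) → ℝ) (a b : Fin (n + 1)) :
    en n (k + 1) (J * G * Jᵀ) (pullF J w) a b =
      ∑ c, ∑ d, J a c * J b d * en n (k + 1) G w c d := by
  have hinv : Jᵀ * (J * G * Jᵀ)⁻¹ * J = G⁻¹ := by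
    rw [Matrix.mul_inv_rev, Matrix.mul_inv_rev]
    have h1 : Jᵀ * (Jᵀ)⁻¹ = 1 := Matrix.mul_nonsing_inv _ (by simpa using hJ)
    have h2 : J⁻¹ * J = 1 := Matrix.nonsing_inv_mul _ hJ
    calc _ = (Jᵀ * (Jᵀ)⁻¹) * G⁻¹ * (J⁻¹ * J) := by simp only [Matrix.mul_assoc]
      _ = _ := by rw [h1, h2]; simp
  simp only [en_eq]
  simp_rw [pullF_cons, contr_sum_left, contr_sum_right, contr_pullF, hinv, conj_apply]
  simp only [mul_sub, Finset.mul_sum, Finset.sum_sub_distrib]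
  congr 1
  · refine Finset.sum_congr rfl fun c _ => Finset.sum_congr rfl fun d _ => ?_
    ring
  · refine Finset.sum_congr rfl fun c _ => Finset.sum_congr rfl fun d _ => ?_
    ring

section Wedge

variable {ι : Type*} {k : ℕ}

/-- Components of the wedge product of `k` covectors. -/
noncomputable def wedge : (ι → ℝ) [⋀^Fin k]→ₗ[ℝ] ((Fin k → ι) → ℝ) :=
  AlternatingMap.pi fun v => Matrix.detRowAlternating.compLinearMap (LinearMap.funLeft ℝ ℝ v)

theorem wedge_apply (θ : Fin k → ι → ℝ) (v : Fin k → ι) :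
    wedge θ v = Matrix.det (Matrix.of fun i j => θ i (v j)) := rfl

theorem wedge_isAlt (θ : Fin k → ι → ℝ) : IsAlt (wedge θ) := by
  intro v σ
  rw [wedge_apply, wedge_apply, ← Matrix.det_permute']
  rfl

theorem pullF_wedge [Fintype ι] (P : Matrix ι ι ℝ) (θ : Fin k → ι → ℝ) :
    pullF P (wedge θ) = wedge fun i => P *ᵥ θ i := by
  ext v
  simp only [pullF, wedge_apply, Matrix.det_apply', Finset.mul_sum]
  rw [Finset.sum_comm]
  refine Finset.sum_congr rfl fun σ _ => ?_
  simp only [Matrix.of_apply, Matrix.mulVec, dotProduct]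
  rw [Finset.prod_univ_sum, Fintype.piFinset_univ, Finset.mul_sum]
  refine Finset.sum_congr rfl fun u _ => ?_
  rw [Finset.prod_mul_distrib]; ring

variable [DecidableEq ι]

/-- The wedge product of the coordinate covectors `u 0, u 1, …`. -/
noncomputable def eb (u : Fin k → ι) : (Fin k → ι) → ℝ := wedge fun i => Pi.single (u i) (1 : ℝ)

theorem eb_apply (u v : Fin k → ι) :
    eb u v = Matrix.det (Matrix.of fun i j => if u i = v j then (1 : ℝ) else 0) := by
  rw [eb, wedge_apply]
  congr 1; ext i j
  simp [Pi.single_apply, eq_comm]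

theorem eb_comp_perm (u : Fin k → ι) (σ : Equiv.Perm (Fin k)) :
    eb (u ∘ σ) = ((Equiv.Perm.sign σ : ℤ) : ℝ) • eb u := by
  have := wedge.map_perm (fun i => Pi.single (M := fun _ : ι => ℝ) (u i) (1 : ℝ)) σ
  rw [eb, eb, Int.cast_smul_eq_zsmul]
  exact this

theorem eb_eq_zero {u : Fin k → ι} (h : ¬ Function.Injective u) : eb u = 0 := by
  simp only [Function.Injective, not_forall] at h
  obtain ⟨i, j, hij, hne⟩ := h
  exact wedge.map_eq_zero_of_eq _ (by simp [hij]) hne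

theorem eb_update_eq (u : Fin k → ι) (p : Fin k) (j : ι) :
    eb (Function.update u p j) =
      wedge (Function.update (fun i => Pi.single (M := fun _ : ι => ℝ) (u i) (1 : ℝ)) p
        (Pi.single j 1)) := by
  unfold eb
  congr 1; ext q : 1
  by_cases h : q = p
  · subst h; simp
  · simp [h]

theorem eb_isAlt (u : Fin k → ι) : IsAlt (eb u) := wedge_isAlt _

theorem sum_smul_eb [Fintype ι] {w : (Fin k → ι) → ℝ} (hw : IsAlt w) :
    ∑ u, w u • eb u = (k.factorial : ℝ) • w := by
  ext v
  simp only [Finset.sum_apply, Pi.smul_apply, smul_eq_mul, eb_apply, Matrix.det_apply',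
    Finset.mul_sum]
  rw [Finset.sum_comm]
  have key : ∀ σ : Equiv.Perm (Fin k), ∑ u : Fin k → ι, w u * (((Equiv.Perm.sign σ : ℤ) : ℝ) *
      ∏ i, (Matrix.of fun i j => if u i = v j then (1 : ℝ) else 0) (σ i) i) = w v := by
    intro σ
    rw [Finset.sum_eq_single (v ∘ σ.symm)]
    · rw [hw]
      have : ∏ i, (Matrix.of fun i j => if (v ∘ σ.symm) i = v j then (1 : ℝ) else 0) (σ i) i
          = 1 := Finset.prod_eq_one fun i _ => by simp
      rw [this, mul_one, Equiv.Perm.sign_symm, mul_comm, ← mul_assoc, ← Int.cast_mul,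
        Int.units_coe_mul_self, Int.cast_one, one_mul]
    · intro u _ hu
      have : ∃ i, u (σ i) ≠ v i := by
        by_contra! h
        exact hu (funext fun i => by simpa using h (σ.symm i))
      obtain ⟨i, hi⟩ := this
      have : ∏ i, (Matrix.of fun i j => if u i = v j then (1 : ℝ) else 0) (σ i) i = 0 :=
        Finset.prod_eq_zero (Finset.mem_univ i) (by simp [hi])
      rw [this]; ring
    · simp
  rw [Finset.sum_congr rfl fun σ _ => key σ]
  simp [Fintype.card_perm]

theorem exists_perm_of_range_eq {ι : Type*} {k : ℕ} {u u' : Fin k → ι} (hu : Function.Injective u)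
    (hu' : Function.Injective u') (h : Set.range u = Set.range u') :
    ∃ σ : Equiv.Perm (Fin k), u' = u ∘ σ := by
  refine ⟨(Equiv.ofInjective u' hu').trans
    ((Equiv.setCongr h.symm).trans (Equiv.ofInjective u hu).symm), ?_⟩
  ext q
  have := Equiv.apply_ofInjective_symm hu
    ((Equiv.setCongr h.symm) ((Equiv.ofInjective u' hu') q))
  simpa using this.symm

end Wedge

theorem eps_mul_self (n : ℕ) (i : Fin (n + 1)) : eps n i * eps n i = 1 := by
  unfold eps; split_ifs <;> norm_num

theorem eps_ne_zero (n : ℕ) (i : Fin (n + 1)) : eps n i ≠ 0 := by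
  unfold eps; split_ifs <;> norm_num

/-- The matrix acting on the coordinate plane spanned by `i` and `j` by
`e_i ↦ c e_i + s e_j`, `e_j ↦ r s e_i + c e_j`, and trivially on the other basis vectors. -/
def planeM {ι : Type*} [DecidableEq ι] (i j : ι) (r c s : ℝ) : Matrix ι ι ℝ := fun a b =>
  if b = i then (if a = i then c else if a = j then s else 0)
  else if b = j then (if a = i then r * s else if a = j then c else 0)
  else if a = b then 1 else 0

section Plane

variable {ι : Type*} [DecidableEq ι] {i j : ι}

theorem planeM_single_left [Fintype ι] (hij : i ≠ j) (r c s : ℝ) :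
    planeM i j r c s *ᵥ Pi.single i 1 = c • Pi.single i (1 : ℝ) + s • Pi.single j 1 := by
  ext a
  simp only [Matrix.mulVec_single_one, Matrix.col_apply, planeM, Pi.add_apply, Pi.smul_apply,
    Pi.single_apply, smul_eq_mul]
  split_ifs <;> simp_all

theorem planeM_single_right [Fintype ι] (hij : i ≠ j) (r c s : ℝ) :
    planeM i j r c s *ᵥ Pi.single j 1 = (r * s) • Pi.single i (1 : ℝ) + c • Pi.single j 1 := by
  ext a
  simp only [Matrix.mulVec_single_one, Matrix.col_apply, planeM, Pi.add_apply, Pi.smul_apply,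
    Pi.single_apply, smul_eq_mul]
  split_ifs <;> simp_all

theorem planeM_single_of_ne [Fintype ι] (r c s : ℝ) {a : ι} (hi : a ≠ i) (hj : a ≠ j) :
    planeM i j r c s *ᵥ Pi.single a 1 = Pi.single a (1 : ℝ) := by
  ext b
  simp only [Matrix.mulVec_single_one, Matrix.col_apply, planeM, Pi.single_apply]
  split_ifs <;> simp_all

theorem sum_planeM_left [Fintype ι] (hij : i ≠ j) (r c s : ℝ) (f : ι → ℝ) :
    ∑ b, planeM i j r c s i b * f b = c * f i + r * s * f j := by
  have : ∀ b, planeM i j r c s i b * f b =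
      (if b = i then c * f b else 0) + (if b = j then r * s * f b else 0) := by
    intro b
    simp only [planeM]
    split_ifs <;> simp_all
  simp [this, Finset.sum_add_distrib]

theorem sum_planeM_right [Fintype ι] (hij : i ≠ j) (r c s : ℝ) (f : ι → ℝ) :
    ∑ b, planeM i j r c s j b * f b = s * f i + c * f j := by
  have : ∀ b, planeM i j r c s j b * f b =
      (if b = i then s * f b else 0) + (if b = j then c * f b else 0) := by
    intro b
    simp only [planeM]
    split_ifs <;> simp_all
  simp [this, Finset.sum_add_distrib]

theorem sum_planeM_of_ne [Fintype ι] (r c s : ℝ) {a : ι} (hi : a ≠ i) (hj : a ≠ j) (f : ι → ℝ) :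
    ∑ b, planeM i j r c s a b * f b = f a := by
  have : ∀ b, planeM i j r c s a b * f b = (if b = a then f b else 0) := by
    intro b
    by_cases hb : b = a
    · subst hb
      simp [planeM, hi, hj]
    · have hba : a ≠ b := Ne.symm hb
      simp only [planeM, hi, hj, hb, hba, if_false]
      split_ifs <;> simp
  simp [this]

end Plane

/-- The value at `(a, b)` of the transform of a 2-covariant array. -/
theorem conj_apply' {ι : Type*} [Fintype ι] (J : Matrix ι ι ℝ) (G : ι → ι → ℝ) (a b : ι) :
    ∑ c, ∑ d, J a c * J b d * G c d = ∑ c, J a c * ∑ d, J b d * G c d := by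
  simp only [Finset.mul_sum]
  exact Finset.sum_congr rfl fun c _ => Finset.sum_congr rfl fun d _ => by ring

/-- Lorentz transformations. -/
def IsLorentz (n : ℕ) (P : Matrix (Fin (n + 1)) (Fin (n + 1)) ℝ) : Prop :=
  P * Matrix.of (minkM n) * Pᵀ = Matrix.of (minkM n)

theorem planeM_isLorentz {n : ℕ} {i j : Fin (n + 1)} (hij : i ≠ j) {c s : ℝ}
    (h : c ^ 2 + eps n i * eps n j * s ^ 2 = 1) :
    IsLorentz n (planeM i j (-(eps n i * eps n j)) c s) := by
  have hi := eps_mul_self n i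
  have hj := eps_mul_self n j
  unfold IsLorentz
  ext a b
  rw [conj_apply]
  simp only [Matrix.of_apply]
  rw [conj_apply']
  by_cases hai : a = i
  · subst hai
    rw [sum_planeM_left hij]
    by_cases hbi : b = a
    · subst hbi
      simp only [sum_planeM_left hij, minkM, hij, hij.symm, if_true, if_false]
      linear_combination eps n b * h + eps n b ^ 2 * eps n j * s ^ 2 * hj
    · by_cases hbj : b = j
      · subst hbj
        simp only [sum_planeM_right hij, minkM, hij, hij.symm, if_true, if_false]
        linear_combination - s * c * eps n a * hj
      · simp only [sum_planeM_of_ne _ _ _ hbi hbj]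
        simp [minkM, Ne.symm hbi, Ne.symm hbj]
  · by_cases haj : a = j
    · subst haj
      rw [sum_planeM_right hij]
      by_cases hbi : b = i
      · subst hbi
        simp only [sum_planeM_left hij, minkM, hij, hij.symm, if_true, if_false]
        linear_combination - s * c * eps n b * hj
      · by_cases hbj : b = a
        · subst hbj
          simp only [sum_planeM_right hij, minkM, hij, hij.symm, if_true, if_false]
          linear_combination eps n b * h - eps n i * s ^ 2 * hj
        · simp only [sum_planeM_of_ne _ _ _ hbi hbj]
          simp [minkM, Ne.symm hbi, Ne.symm hbj]
    · rw [sum_planeM_of_ne _ _ _ hai haj]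
      by_cases hbi : b = i
      · subst hbi
        simp only [sum_planeM_left hij]
        simp [minkM, hai, haj]
      · by_cases hbj : b = j
        · subst hbj
          simp only [sum_planeM_right hij]
          simp [minkM, hai, haj]
        · simp only [sum_planeM_of_ne _ _ _ hbi hbj]

theorem exists_plane_params (n : ℕ) (i j : Fin (n + 1)) :
    ∃ c s : ℝ, c ≠ 0 ∧ s ≠ 0 ∧ c ^ 2 + eps n i * eps n j * s ^ 2 = 1 := by
  have : eps n i * eps n j = 1 ∨ eps n i * eps n j = -1 := by
    unfold eps; split_ifs <;> norm_num
  rcases this with h | h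
  · exact ⟨3 / 5, 4 / 5, by norm_num, by norm_num, by rw [h]; norm_num⟩
  · exact ⟨5 / 3, 4 / 3, by norm_num, by norm_num, by rw [h]; norm_num⟩

/-- The matrix of the reflection in the coordinate `c`. -/
def reflM {ι : Type*} [DecidableEq ι] (c : ι) : Matrix ι ι ℝ :=
  Matrix.diagonal fun a => if a = c then -1 else 1

theorem reflM_isLorentz {n : ℕ} (c : Fin (n + 1)) : IsLorentz n (reflM c) := by
  unfold IsLorentz
  ext a b
  simp only [reflM, Matrix.diagonal_transpose, Matrix.mul_diagonal, Matrix.diagonal_mul,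
    Matrix.of_apply, minkM]
  split_ifs <;> simp_all

theorem pullF_reflM_eb {ι : Type*} [Fintype ι] [DecidableEq ι] {k : ℕ} (c : ι) (u : Fin k → ι)
    (hu : Function.Injective u) :
    pullF (reflM c) (eb u) = (if c ∈ Set.range u then (-1 : ℝ) else 1) • eb u := by
  unfold eb
  rw [pullF_wedge]
  have h1 : (fun i => reflM c *ᵥ Pi.single (M := fun _ : ι => ℝ) (u i) (1 : ℝ)) =
      fun i => (if u i = c then (-1 : ℝ) else 1) • Pi.single (M := fun _ : ι => ℝ) (u i) (1 : ℝ) := by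
    ext i a
    simp only [reflM, Matrix.mulVec_diagonal, Pi.smul_apply, Pi.single_apply, smul_eq_mul]
    split_ifs <;> simp_all
  rw [h1]
  have := wedge.toMultilinearMap.map_smul_univ (fun i => if u i = c then (-1 : ℝ) else 1)
    (fun i => Pi.single (M := fun _ : ι => ℝ) (u i) (1 : ℝ))
  refine this.trans ?_
  congr 1
  split_ifs with h
  · obtain ⟨p, rfl⟩ := h
    rw [Finset.prod_eq_single p] <;> simp +contextual [hu.eq_iff]
  · exact Finset.prod_eq_one fun q _ => by
      rw [if_neg]; rintro rfl; exact h ⟨q, rfl⟩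

/-- Bilinear maps on alternating arrays, with values in 2-covariant arrays, that are symmetric and
whose diagonal is Lorentz equivariant. -/
structure IsEquivariantForm (n k : ℕ)
    (β : Fin (n + 1) → Fin (n + 1) →
      (((Fin k → Fin (n + 1)) → ℝ) →ₗ[ℝ] ((Fin k → Fin (n + 1)) → ℝ) →ₗ[ℝ] ℝ)) : Prop where
  symm : ∀ a b w w', β a b w w' = β a b w' w
  equivariant : ∀ P, IsLorentz n P → ∀ w, IsAlt w → ∀ a b,
    β a b (pullF P w) (pullF P w) = ∑ c, P a c * ∑ d, P b d * β c d w w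

namespace IsEquivariantForm

variable {n k : ℕ} {β : Fin (n + 1) → Fin (n + 1) →
  (((Fin k → Fin (n + 1)) → ℝ) →ₗ[ℝ] ((Fin k → Fin (n + 1)) → ℝ) →ₗ[ℝ] ℝ)}

theorem equivariant_pair (h : IsEquivariantForm n k β) {P} (hP : IsLorentz n P) {w w'}
    (hw : IsAlt w) (hw' : IsAlt w') (a b : Fin (n + 1)) :
    β a b (pullF P w) (pullF P w') = ∑ c, P a c * ∑ d, P b d * β c d w w' := by
  have h1 := h.equivariant P hP w hw a b
  have h2 := h.equivariant P hP w' hw' a b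
  have h3 := h.equivariant P hP _ (hw.add hw') a b
  simp only [pullF_add, map_add, LinearMap.add_apply, h1, h2, mul_add, Finset.sum_add_distrib,
    h.symm _ _ w' w, h.symm _ _ (pullF P w') (pullF P w)] at h3
  linarith

theorem parity (h : IsEquivariantForm n k β) {u u' : Fin k → Fin (n + 1)}
    (hu : Function.Injective u) (hu' : Function.Injective u') {a b : Fin (n + 1)}
    (hne : β a b (eb u) (eb u') ≠ 0) (c : Fin (n + 1)) :
    (if c ∈ Set.range u then (-1 : ℝ) else 1) * (if c ∈ Set.range u' then -1 else 1) =
      (if a = c then -1 else 1) * (if b = c then -1 else 1) := by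
  have := h.equivariant_pair (reflM_isLorentz c) (eb_isAlt u) (eb_isAlt u') a b
  rw [pullF_reflM_eb _ _ hu, pullF_reflM_eb _ _ hu'] at this
  simp only [map_smul, LinearMap.smul_apply,
    smul_eq_mul, reflM, Matrix.diagonal_apply, ite_mul, zero_mul, Finset.sum_ite_eq,
    Finset.mem_univ, if_true] at this
  apply mul_right_cancel₀ hne
  clear hne
  split_ifs at this ⊢ <;> linarith

theorem offdiag (h : IsEquivariantForm n k β) {u : Fin k → Fin (n + 1)}
    (hu : Function.Injective u) {a b : Fin (n + 1)} (hab : a ≠ b) :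
    β a b (eb u) (eb u) = 0 := by
  by_contra hne
  have := h.parity hu hu hne a
  simp only [if_true, hab.symm, if_false] at this
  split_ifs at this <;> norm_num at this

theorem update_injective {ι : Type*} {u : Fin k → ι} (hu : Function.Injective u)
    (p : Fin k) {j : ι} (hj : j ∉ Set.range u) : Function.Injective (Function.update u p j) := by
  classical
  intro x y hxy
  by_cases hx : x = p
  · by_cases hy : y = p
    · rw [hx, hy]
    · subst hx
      rw [Function.update_self, Function.update_of_ne hy] at hxy
      exact absurd ⟨y, hxy.symm⟩ hj
  · by_cases hy : y = p
    · subst hy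
      rw [Function.update_self, Function.update_of_ne hx] at hxy
      exact absurd ⟨x, hxy⟩ hj
    · rw [Function.update_of_ne hx, Function.update_of_ne hy] at hxy
      exact hu hxy

theorem notMem_range_update {ι : Type*} {u : Fin k → ι} (hu : Function.Injective u)
    (p : Fin k) {j : ι} (hj : j ∉ Set.range u) : u p ∉ Set.range (Function.update u p j) := by
  rintro ⟨q, hq⟩
  by_cases h : q = p
  · subst h
    rw [Function.update_self] at hq
    exact hj ⟨q, hq.symm⟩
  · rw [Function.update_of_ne h] at hq
    exact h (hu hq)

theorem eq_zero_update (h : IsEquivariantForm n k β) {u : Fin k → Fin (n + 1)}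
    (hu : Function.Injective u) (p : Fin k) {j : Fin (n + 1)} (hj : j ∉ Set.range u)
    (a : Fin (n + 1)) : β a a (eb u) (eb (Function.update u p j)) = 0 := by
  by_contra hne
  have := h.parity hu (update_injective hu p hj) hne (u p)
  rw [if_pos ⟨p, rfl⟩, if_neg (notMem_range_update hu p hj)] at this
  split_ifs at this <;> norm_num at this

theorem pullF_planeM_eb {ι : Type*} [Fintype ι] [DecidableEq ι] {u : Fin k → ι}
    (hu : Function.Injective u) (p : Fin k) {j : ι} (hj : j ∉ Set.range u) (r c s : ℝ) :
    pullF (planeM (u p) j r c s) (eb u) = c • eb u + s • eb (Function.update u p j) := by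
  have hpj : u p ≠ j := fun e => hj ⟨p, e⟩
  have : (fun q => planeM (u p) j r c s *ᵥ Pi.single (M := fun _ : ι => ℝ) (u q) (1 : ℝ)) =
      Function.update (fun q => Pi.single (M := fun _ : ι => ℝ) (u q) (1 : ℝ)) p
        (c • Pi.single (u p) (1 : ℝ) + s • Pi.single j 1) := by
    ext1 q
    by_cases hq : q = p
    · subst hq; rw [Function.update_self, planeM_single_left hpj]
    · rw [Function.update_of_ne hq, planeM_single_of_ne]
      · exact fun e => hq (hu e)
      · exact fun e => hj ⟨q, e⟩
  rw [eb_update_eq, eb, pullF_wedge, this, wedge.map_update_add, wedge.map_update_smul,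
    wedge.map_update_smul]
  congr 3
  exact Function.update_eq_self p _

theorem pullF_planeM_eb_of_notMem {ι : Type*} [Fintype ι] [DecidableEq ι] {u : Fin k → ι}
    {i j : ι} (hi : i ∉ Set.range u) (hj : j ∉ Set.range u) (r c s : ℝ) :
    pullF (planeM i j r c s) (eb u) = eb u := by
  unfold eb
  rw [pullF_wedge]
  congr 1
  ext1 q
  exact planeM_single_of_ne _ _ _ (fun e => hi ⟨q, e⟩) (fun e => hj ⟨q, e⟩)

theorem pullF_planeM_eb_of_mem {ι : Type*} [Fintype ι] [DecidableEq ι] {u : Fin k → ι}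
    (hu : Function.Injective u) {p q : Fin k} (hpq : p ≠ q) {r c s : ℝ}
    (h : c ^ 2 - r * s ^ 2 = 1) :
    pullF (planeM (u p) (u q) r c s) (eb u) = eb u := by
  have hne : u p ≠ u q := fun e => hpq (hu e)
  set θ : Fin k → ι → ℝ := fun q => Pi.single (M := fun _ : ι => ℝ) (u q) (1 : ℝ) with hθ
  have : (fun x => planeM (u p) (u q) r c s *ᵥ θ x) =
      Function.update (Function.update θ p (c • θ p + s • θ q)) q ((r * s) • θ p + c • θ q) := by
    ext1 x
    by_cases hq : x = q
    · subst hq; rw [Function.update_self]; exact planeM_single_right hne _ _ _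
    · rw [Function.update_of_ne hq]
      by_cases hp : x = p
      · subst hp; rw [Function.update_self]; exact planeM_single_left hne _ _ _
      · rw [Function.update_of_ne hp]
        exact planeM_single_of_ne _ _ _ (fun e => hp (hu e)) (fun e => hq (hu e))
  have h1 : wedge (Function.update (Function.update θ p (θ p)) q (θ q)) = wedge θ := by simp
  have h2 : wedge (Function.update (Function.update θ p (θ q)) q (θ q)) = 0 :=
    wedge.map_eq_zero_of_eq _ (by simp [hpq]) hpq
  have h3 : wedge (Function.update (Function.update θ p (θ p)) q (θ p)) = 0 :=
    wedge.map_eq_zero_of_eq _ (by simp [hpq]) hpq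
  have h4 : wedge (Function.update (Function.update θ p (θ q)) q (θ p)) = -wedge θ := by
    rw [← wedge.map_swap θ hpq]
    congr 1
    ext1 x
    by_cases hq : x = q
    · subst hq; simp
    · by_cases hp : x = p
      · subst hp; simp [hpq]
      · simp [hq, hp, Equiv.swap_apply_of_ne_of_ne]
  change pullF _ (wedge θ) = wedge θ
  rw [pullF_wedge, this, wedge.map_update_add, wedge.map_update_smul, wedge.map_update_smul]
  simp only [Function.update_comm hpq]
  simp only [wedge.map_update_add, wedge.map_update_smul]
  simp only [Function.update_comm hpq.symm, h1, h2, h3, h4]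
  have : c * c - r * s * s = 1 := by linarith [h, sq c, sq s]
  ext v
  simp only [Pi.add_apply, Pi.smul_apply, Pi.neg_apply, Pi.zero_apply, smul_eq_mul]
  linear_combination (wedge θ v) * this

theorem plane_relations (h : IsEquivariantForm n k β) {u : Fin k → Fin (n + 1)}
    (hu : Function.Injective u) (p : Fin k) {j : Fin (n + 1)} (hj : j ∉ Set.range u) :
    β (u p) (u p) (eb (Function.update u p j)) (eb (Function.update u p j)) =
      β j j (eb u) (eb u) ∧
    β j j (eb (Function.update u p j)) (eb (Function.update u p j)) =
      β (u p) (u p) (eb u) (eb u) ∧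
    2 * β (u p) j (eb u) (eb (Function.update u p j)) =
      β (u p) (u p) (eb u) (eb u) - eps n (u p) * eps n j * β j j (eb u) (eb u) ∧
    2 * β j (u p) (eb u) (eb (Function.update u p j)) =
      β (u p) (u p) (eb u) (eb u) - eps n (u p) * eps n j * β j j (eb u) (eb u) ∧
    ∀ a, a ≠ u p → a ≠ j →
      β a a (eb (Function.update u p j)) (eb (Function.update u p j)) =
        eps n (u p) * eps n j * β a a (eb u) (eb u) := by
  have hpj : u p ≠ j := fun e => hj ⟨p, e⟩
  obtain ⟨c, s, hc, hs, hcs⟩ := exists_plane_params n (u p) j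
  have E := fun a b => h.equivariant _ (planeM_isLorentz hpj hcs) _ (eb_isAlt u) a b
  simp only [pullF_planeM_eb hu p hj, map_add, map_smul, LinearMap.add_apply,
    LinearMap.smul_apply, smul_eq_mul] at E
  simp only [h.symm _ _ (eb (Function.update u p j)) (eb u)] at E
  have z := h.eq_zero_update hu p hj
  have o1 := h.offdiag hu hpj
  have o2 := h.offdiag hu hpj.symm
  have hu' := update_injective hu p hj
  have o3 := h.offdiag hu' hpj
  have o4 := h.offdiag hu' hpj.symm
  have e1 := E (u p) (u p)
  have e2 := E j j
  have e3 := E (u p) j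
  have e4 := E j (u p)
  simp only [sum_planeM_left hpj, sum_planeM_right hpj, z, o1, o2, o3, o4] at e1 e2 e3 e4
  have hee : (eps n (u p) * eps n j) * (eps n (u p) * eps n j) = 1 := by
    linear_combination (eps n j * eps n j) * eps_mul_self n (u p) + eps_mul_self n j
  refine ⟨?_, ?_, ?_, ?_, ?_⟩
  · apply mul_left_cancel₀ (pow_ne_zero 2 hs)
    linear_combination e1 + s ^ 2 * β j j (eb u) (eb u) * hee
  · apply mul_left_cancel₀ (pow_ne_zero 2 hs)
    linear_combination e2
  · apply mul_left_cancel₀ (mul_ne_zero hc hs)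
    linear_combination e3
  · apply mul_left_cancel₀ (mul_ne_zero hc hs)
    linear_combination e4
  · intro a ha ha'
    have e5 := E a a
    simp only [sum_planeM_of_ne _ _ _ ha ha', z] at e5
    apply mul_left_cancel₀ (pow_ne_zero 2 hs)
    linear_combination e5 - β a a (eb u) (eb u) * hcs

theorem diag_relation (h : IsEquivariantForm n k β) {u : Fin k → Fin (n + 1)}
    (hu : Function.Injective u) {i j : Fin (n + 1)} (hij : i ≠ j)
    (hmem : i ∈ Set.range u ↔ j ∈ Set.range u) :
    β i i (eb u) (eb u) = eps n i * eps n j * β j j (eb u) (eb u) := by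
  obtain ⟨c, s, hc, hs, hcs⟩ := exists_plane_params n i j
  have inv : pullF (planeM i j (-(eps n i * eps n j)) c s) (eb u) = eb u := by
    by_cases hi : i ∈ Set.range u
    · obtain ⟨q, rfl⟩ := hmem.1 hi
      obtain ⟨p, rfl⟩ := hi
      exact pullF_planeM_eb_of_mem hu (fun e => hij (congrArg u e)) (by linarith)
    · exact pullF_planeM_eb_of_notMem hi (fun e => hi (hmem.2 e)) _ _ _
  have e := h.equivariant _ (planeM_isLorentz hij hcs) _ (eb_isAlt u) i j
  simp only [inv, sum_planeM_left hij, sum_planeM_right hij, h.offdiag hu hij,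
    h.offdiag hu hij.symm] at e
  apply mul_left_cancel₀ (mul_ne_zero hc hs)
  linear_combination -e

theorem swap_diag (h : IsEquivariantForm n k β) {u : Fin k → Fin (n + 1)}
    (hu : Function.Injective u) {i j : Fin (n + 1)} (hij : i ≠ j) {c : Fin (n + 1)}
    (hz : β c c (eb u) (eb u) = 0) :
    β (Equiv.swap i j c) (Equiv.swap i j c) (eb (Equiv.swap i j ∘ u))
      (eb (Equiv.swap i j ∘ u)) = 0 := by
  have mixed : ∀ p, ∀ j, j ∉ Set.range u →
      β (Equiv.swap (u p) j c) (Equiv.swap (u p) j c) (eb (Equiv.swap (u p) j ∘ u))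
      (eb (Equiv.swap (u p) j ∘ u)) = 0 := by
    intro p j hj
    obtain ⟨r1, r2, -, -, r3⟩ := h.plane_relations hu p hj
    have : Equiv.swap (u p) j ∘ u = Function.update u p j := by
      ext1 q
      by_cases hq : q = p
      · subst hq; simp
      · rw [Function.update_of_ne hq]
        exact Equiv.swap_apply_of_ne_of_ne (fun e => hq (hu e)) (fun e => hj ⟨q, e⟩)
    rw [this]
    by_cases h1 : c = u p
    · subst h1; rw [Equiv.swap_apply_left, r2, hz]
    · by_cases h2 : c = j
      · subst h2; rw [Equiv.swap_apply_right, r1, hz]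
      · rw [Equiv.swap_apply_of_ne_of_ne h1 h2, r3 c h1 h2, hz, mul_zero]
  by_cases hi : i ∈ Set.range u <;> by_cases hj : j ∈ Set.range u
  · obtain ⟨p, rfl⟩ := hi
    obtain ⟨q, rfl⟩ := hj
    have : Equiv.swap (u p) (u q) ∘ u = u ∘ Equiv.swap p q := by
      ext1 x
      exact (Function.Injective.map_swap hu p q x).symm
    rw [this, eb_comp_perm]
    simp only [map_smul, LinearMap.smul_apply, smul_eq_mul]
    have r := h.diag_relation hu hij (by simp)
    suffices β (Equiv.swap (u p) (u q) c) (Equiv.swap (u p) (u q) c) (eb u) (eb u) = 0 by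
      rw [this]; ring
    by_cases h1 : c = u p
    · subst h1
      rw [Equiv.swap_apply_left]
      simpa [eps_ne_zero, hz] using r
    · by_cases h2 : c = u q
      · subst h2
        rw [Equiv.swap_apply_right, r, hz, mul_zero]
      · rw [Equiv.swap_apply_of_ne_of_ne h1 h2, hz]
  · obtain ⟨p, rfl⟩ := hi
    exact mixed p j hj
  · obtain ⟨p, rfl⟩ := hj
    rw [Equiv.swap_comm]
    exact mixed p i hi
  · have : Equiv.swap i j ∘ u = u := by
      ext1 x
      exact Equiv.swap_apply_of_ne_of_ne (fun e => hi ⟨x, e⟩) (fun e => hj ⟨x, e⟩)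
    rw [this]
    have r := h.diag_relation hu hij (by simp [hi, hj])
    by_cases h1 : c = i
    · subst h1
      rw [Equiv.swap_apply_left]
      simpa [eps_ne_zero, hz] using r
    · by_cases h2 : c = j
      · subst h2
        rw [Equiv.swap_apply_right, r, hz, mul_zero]
      · rw [Equiv.swap_apply_of_ne_of_ne h1 h2, hz]

theorem perm_diag (h : IsEquivariantForm n k β) (π : Equiv.Perm (Fin (n + 1)))
    {u : Fin k → Fin (n + 1)} (hu : Function.Injective u) {c : Fin (n + 1)}
    (hz : β c c (eb u) (eb u) = 0) :
    β (π c) (π c) (eb (π ∘ u)) (eb (π ∘ u)) = 0 := by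
  induction π using Equiv.Perm.swap_induction_on with
  | one => simpa using hz
  | swap_mul f x y hxy ih => exact h.swap_diag (f.injective.comp hu) hxy ih

theorem exists_perm_comp_eq {α ι : Type*} [Finite ι] {f g : α → ι}
    (hf : Function.Injective f) (hg : Function.Injective g) :
    ∃ π : Equiv.Perm ι, π ∘ f = g := by
  classical
  let e : Set.range f ≃ Set.range g :=
    (Equiv.ofInjective f hf).symm.trans (Equiv.ofInjective g hg)
  refine ⟨e.extendSubtype, ?_⟩
  ext1 x
  rw [Function.comp_apply, Equiv.extendSubtype_apply_of_mem e (f x) ⟨x, rfl⟩]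
  have : (⟨f x, ⟨x, rfl⟩⟩ : Set.range f) = Equiv.ofInjective f hf x := rfl
  change ((Equiv.ofInjective g hg) ((Equiv.ofInjective f hf).symm ⟨f x, _⟩) : ι) = g x
  rw [this, Equiv.symm_apply_apply]
  rfl

theorem diag_eq_zero (h : IsEquivariantForm n k β)
    (hin : ∃ (u : Fin k → Fin (n + 1)) (p : Fin k), Function.Injective u ∧
      β (u p) (u p) (eb u) (eb u) = 0)
    (hout : k ≤ n → ∃ (u : Fin k → Fin (n + 1)) (c : Fin (n + 1)), Function.Injective u ∧
      c ∉ Set.range u ∧ β c c (eb u) (eb u) = 0)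
    {u : Fin k → Fin (n + 1)} (hu : Function.Injective u) (c : Fin (n + 1)) :
    β c c (eb u) (eb u) = 0 := by
  by_cases hc : c ∈ Set.range u
  · obtain ⟨q, rfl⟩ := hc
    obtain ⟨u0, p, hu0, hz⟩ := hin
    obtain ⟨π, hπ⟩ := exists_perm_comp_eq (hu0.comp (Equiv.swap p q).injective) hu
    have hz' : β (u0 p) (u0 p) (eb (u0 ∘ Equiv.swap p q)) (eb (u0 ∘ Equiv.swap p q)) = 0 := by
      rw [eb_comp_perm]
      simp [hz]
    have := h.perm_diag π (hu0.comp (Equiv.swap p q).injective) hz'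
    rw [hπ] at this
    have hq : π (u0 p) = u q := by
      rw [← congrFun hπ q]; simp
    rwa [hq] at this
  · have hk : k ≤ n := by
      have := Fintype.card_le_of_injective _
        (Fin.cons_injective_iff.2 ⟨hc, hu⟩ : Function.Injective (Fin.cons c u : Fin (k + 1) → _))
      simpa using this
    obtain ⟨u0, c0, hu0, hc0, hz⟩ := hout hk
    obtain ⟨π, hπ⟩ := exists_perm_comp_eq
      (Fin.cons_injective_iff.2 ⟨hc0, hu0⟩ : Function.Injective (Fin.cons c0 u0 : Fin (k + 1) → _))
      (Fin.cons_injective_iff.2 ⟨hc, hu⟩ : Function.Injective (Fin.cons c u : Fin (k + 1) → _))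
    have h1 : π c0 = c := by simpa using congrFun hπ 0
    have h2 : π ∘ u0 = u := by
      ext1 x
      simpa using congrFun hπ x.succ
    have := h.perm_diag π hu0 hz
    rwa [h1, h2] at this

theorem eb_eq_zero_of_diag (h : IsEquivariantForm n k β)
    (hd : ∀ u : Fin k → Fin (n + 1), Function.Injective u → ∀ c, β c c (eb u) (eb u) = 0)
    (u u' : Fin k → Fin (n + 1)) (a b : Fin (n + 1)) : β a b (eb u) (eb u') = 0 := by
  by_cases hu : Function.Injective u
  swap
  · simp [eb_eq_zero hu]
  by_cases hu' : Function.Injective u'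
  swap
  · simp [eb_eq_zero hu']
  by_contra hne
  by_cases hr : Set.range u = Set.range u'
  · obtain ⟨σ, rfl⟩ := exists_perm_of_range_eq hu hu' hr
    apply hne
    rw [eb_comp_perm, map_smul]
    by_cases hab : a = b
    · subst hab; simp [hd u hu]
    · simp [h.offdiag hu hab]
  · have hcard : (Set.range u).ncard = (Set.range u').ncard := by
      rw [Set.ncard_eq_toFinset_card', Set.ncard_eq_toFinset_card', Set.toFinset_range,
        Set.toFinset_range, Finset.card_image_of_injective _ hu,
        Finset.card_image_of_injective _ hu']
    have h1 : ¬ Set.range u ⊆ Set.range u' := fun hs =>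
      hr (Set.eq_of_subset_of_ncard_le hs hcard.ge)
    have h2 : ¬ Set.range u' ⊆ Set.range u := fun hs =>
      hr (Set.eq_of_subset_of_ncard_le hs hcard.le).symm
    obtain ⟨i, ⟨p, rfl⟩, hi'⟩ := Set.not_subset.1 h1
    obtain ⟨j, hj', hj⟩ := Set.not_subset.1 h2
    have hpj : u p ≠ j := fun e => hj ⟨p, e⟩
    have par := h.parity hu hu' hne
    have pi := par (u p)
    have pj := par j
    rw [if_pos ⟨p, rfl⟩, if_neg hi'] at pi
    rw [if_neg hj, if_pos hj'] at pj
    have hab : (a = u p ∧ b = j) ∨ (a = j ∧ b = u p) := by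
      by_cases ha : a = u p
      · have hb : ¬ b = u p := by
          intro hb; simp [ha, hb] at pi; norm_num at pi
        by_cases hbj : b = j
        · exact Or.inl ⟨ha, hbj⟩
        · simp [ha, hbj, hpj] at pj; norm_num at pj
      · by_cases hb : b = u p
        · by_cases haj : a = j
          · exact Or.inr ⟨haj, hb⟩
          · simp [hb, haj, hpj] at pj; norm_num at pj
        · simp [ha, hb] at pi; norm_num at pi
    have hrange : Set.range (Function.update u p j) = Set.range u' := by
      have hsub : Set.range (Function.update u p j) ⊆ Set.range u' := by
        rintro _ ⟨q, rfl⟩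
        by_cases hq : q = p
        · subst hq; simpa using hj'
        · rw [Function.update_of_ne hq]
          by_contra hx
          have := par (u q)
          rw [if_pos ⟨q, rfl⟩, if_neg hx] at this
          have n1 : u p ≠ u q := fun e => hq (hu e).symm
          have n2 : j ≠ u q := fun e => hj ⟨q, e.symm⟩
          rcases hab with ⟨rfl, rfl⟩ | ⟨rfl, rfl⟩ <;> simp [n1, n2] at this <;> norm_num at this
      refine Set.eq_of_subset_of_ncard_le hsub ?_
      rw [← hcard, Set.ncard_eq_toFinset_card', Set.ncard_eq_toFinset_card', Set.toFinset_range,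
        Set.toFinset_range, Finset.card_image_of_injective _ hu,
        Finset.card_image_of_injective _ (update_injective hu p hj)]
    obtain ⟨σ, rfl⟩ := exists_perm_of_range_eq (update_injective hu p hj) hu' hrange
    obtain ⟨-, -, r1, r2, -⟩ := h.plane_relations hu p hj
    apply hne
    rw [eb_comp_perm, map_smul]
    simp only [hd u hu] at r1 r2
    rcases hab with ⟨rfl, rfl⟩ | ⟨rfl, rfl⟩
    · have : β (u p) b (eb u) (eb (Function.update u p b)) = 0 := by linarith
      simp [this]
    · have : β a (u p) (eb u) (eb (Function.update u p a)) = 0 := by linarith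
      simp [this]

theorem eq_zero (h : IsEquivariantForm n k β)
    (hin : ∃ (u : Fin k → Fin (n + 1)) (p : Fin k), Function.Injective u ∧
      β (u p) (u p) (eb u) (eb u) = 0)
    (hout : k ≤ n → ∃ (u : Fin k → Fin (n + 1)) (c : Fin (n + 1)), Function.Injective u ∧
      c ∉ Set.range u ∧ β c c (eb u) (eb u) = 0)
    {w : (Fin k → Fin (n + 1)) → ℝ} (hw : IsAlt w) (a b : Fin (n + 1)) : β a b w w = 0 := by
  have hz := h.eb_eq_zero_of_diag (fun u hu c => h.diag_eq_zero hin hout hu c)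
  have h1 : β a b ((k.factorial : ℝ) • w) ((k.factorial : ℝ) • w) = 0 := by
    rw [← sum_smul_eb hw]
    simp [map_sum, hz]
  have hk : (k.factorial : ℝ) ≠ 0 := by positivity
  simpa [hk] using h1

end IsEquivariantForm

/-- A smooth function that is homogeneous of degree two near the origin is a quadratic form. -/
theorem exists_bilin_of_homogeneous {V : Type*} [NormedAddCommGroup V] [NormedSpace ℝ V]
    {P : Set V} (hP : IsOpen P) (h0 : (0 : V) ∈ P) {f : V → ℝ}
    (hf : ContDiffOn ℝ (⊤ : ℕ∞) f P)
    (hom : ∀ q ∈ P, ∀ t : ℝ, 0 < t → t ≤ 1 → t • q ∈ P ∧ f (t • q) = t ^ 2 * f q) :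
    ∃ B : V →ₗ[ℝ] V →ₗ[ℝ] ℝ, (∀ x y, B x y = B y x) ∧ ∀ q ∈ P, f q = B q q := by
  have hf0 : ContDiffAt ℝ (⊤ : ℕ∞) f 0 := hf.contDiffAt (hP.mem_nhds h0)
  have hd : DifferentiableAt ℝ (fderiv ℝ f) 0 := by
    have : ContDiffAt ℝ 1 (fderiv ℝ f) 0 := hf0.fderiv_right (m := 1)
      (WithTop.coe_le_coe.2 (le_top : (2 : ℕ∞) ≤ ⊤))
    exact this.differentiableAt one_ne_zero
  set D := fderiv ℝ (fderiv ℝ f) 0 with hD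
  have hsymm : IsSymmSndFDerivAt ℝ f 0 :=
    hf0.isSymmSndFDerivAt (by
      simpa using WithTop.coe_le_coe.2 (le_top : (2 : ℕ∞) ≤ ⊤))
  refine ⟨(1 / 2 : ℝ) • ((ContinuousLinearMap.coeLM ℝ).comp D.toLinearMap), ?_, ?_⟩
  · intro x y
    simpa using hsymm x y
  intro q hq
  have key : ∀ t ∈ Set.Ioo (0 : ℝ) 1, fderiv ℝ f (t • q) q = 2 * t * f q := by
    intro t ht
    have h1 : HasDerivAt (fun s : ℝ => f (s • q)) (fderiv ℝ f (t • q) q) t := by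
      have hdf : HasFDerivAt f (fderiv ℝ f (t • q)) (t • q) :=
        ((hf.contDiffAt (hP.mem_nhds (hom q hq t ht.1 ht.2.le).1)).differentiableAt
          (by simp)).hasFDerivAt
      have hs : HasDerivAt (fun s : ℝ => s • q) q t := by
        simpa using (hasDerivAt_id t).smul_const q
      exact hdf.comp_hasDerivAt t hs
    have h2 : HasDerivAt (fun s : ℝ => f (s • q)) (2 * t * f q) t := by
      have : HasDerivAt (fun s : ℝ => s ^ 2 * f q) (2 * t * f q) t := by
        simpa using (hasDerivAt_pow 2 t).mul_const (f q)
      refine this.congr_of_eventuallyEq ?_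
      filter_upwards [isOpen_Ioo.mem_nhds ht] with s hs
      exact (hom q hq s hs.1 hs.2.le).2
    exact h1.unique h2
  have hs : HasDerivAt (fun s : ℝ => s • q) q 0 := by
    simpa using (hasDerivAt_id (0 : ℝ)).smul_const q
  have hder : HasDerivAt (fun t : ℝ => fderiv ℝ f (t • q) q) (D q q) 0 := by
    have hD' : HasFDerivAt (fderiv ℝ f) D ((0 : ℝ) • q) := by
      rw [zero_smul]; exact hd.hasFDerivAt
    have := hD'.comp_hasDerivAt (0 : ℝ) hs
    exact ((ContinuousLinearMap.apply ℝ ℝ q).hasFDerivAt.comp_hasDerivAt (0 : ℝ) this)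
  have hev : (fun t : ℝ => fderiv ℝ f (t • q) q) =ᶠ[nhdsWithin 0 (Set.Ioi 0)]
      fun t => 2 * t * f q := by
    filter_upwards [Ioo_mem_nhdsGT (zero_lt_one' ℝ)] with t ht using key t ht
  have hlin : HasDerivAt (fun t : ℝ => 2 * t * f q) (2 * f q) 0 := by
    simpa using ((hasDerivAt_id (0 : ℝ)).const_mul 2).mul_const (f q)
  have hval : fderiv ℝ f ((0 : ℝ) • q) q = 2 * 0 * f q := by
    refine tendsto_nhds_unique
      (hder.continuousAt.tendsto.mono_left (nhdsWithin_le_nhds (s := Set.Ioi 0)))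
      (Filter.Tendsto.congr' hev.symm ?_)
    exact hlin.continuousAt.tendsto.mono_left nhdsWithin_le_nhds
  have h3 : HasDerivWithinAt (fun t : ℝ => fderiv ℝ f (t • q) q) (2 * f q) (Set.Ioi 0) 0 :=
    hlin.hasDerivWithinAt.congr_of_eventuallyEq hev hval
  have h4 := (uniqueDiffWithinAt_Ioi (0 : ℝ)).eq_deriv _ hder.hasDerivWithinAt h3
  change f q = 1 / 2 * D q q
  rw [h4]
  ring

theorem sum_minkM_mul (n : ℕ) (a : Fin (n + 1)) (f : Fin (n + 1) → ℝ) :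
    ∑ c, minkM n a c * f c = eps n a * f a := by
  simp [minkM, ite_mul]

/-- Symmetric matrices close to the Minkowski matrix are congruent to it. -/
theorem exists_congruent_minkM (n : ℕ) : ∃ δ > 0, ∀ G : Fin (n + 1) → Fin (n + 1) → ℝ,
    (∀ a b, G a b = G b a) → (∀ a b, |G a b - minkM n a b| < δ) →
    ∃ P : Matrix (Fin (n + 1)) (Fin (n + 1)) ℝ, IsUnit P.det ∧
      ∀ a b, (∑ c, ∑ d, P c a * G c d * P d b) = minkM n a b := by
  let Φ : (Fin (n + 1) → Fin (n + 1) → ℝ) → Fin (n + 1) → Fin (n + 1) → ℝ := fun M a b =>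
    ∑ c, M c a * eps n c * M c b + (eps n a * M a b - eps n b * M b a)
  let I : Fin (n + 1) → Fin (n + 1) → ℝ := fun a b => if a = b then 1 else 0
  have hΦ : ContDiff ℝ 1 Φ := by
    refine contDiff_pi.2 fun a => contDiff_pi.2 fun b => ?_
    fun_prop
  have hap : ∀ (t : ℝ) X a b, (I + t • X) a b = I a b + t * X a b := fun _ _ _ _ => rfl
  have hstrict : HasStrictFDerivAt Φ (fderiv ℝ Φ I) I :=
    hΦ.contDiffAt.hasStrictFDerivAt one_ne_zero
  have hder : ∀ X : Fin (n + 1) → Fin (n + 1) → ℝ, fderiv ℝ Φ I X = fun a b => 2 * (eps n a * X a b) := by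
    intro X
    have h1 : HasDerivAt (fun t : ℝ => Φ (I + t • X)) (fderiv ℝ Φ I X) 0 := by
      have hs : HasDerivAt (fun t : ℝ => I + t • X) X 0 := by
        simpa only [one_smul, id] using ((hasDerivAt_id (0 : ℝ)).smul_const X).const_add I
      have hd : HasFDerivAt Φ (fderiv ℝ Φ I) (I + (0 : ℝ) • X) := by
        rw [zero_smul, add_zero]; exact hstrict.hasFDerivAt
      exact hd.comp_hasDerivAt (0 : ℝ) hs
    have h2 : HasDerivAt (fun t : ℝ => Φ (I + t • X)) (fun a b => 2 * (eps n a * X a b)) 0 := by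
      refine hasDerivAt_pi.2 fun a => hasDerivAt_pi.2 fun b => ?_
      have : (fun t : ℝ => Φ (I + t • X) a b) = fun t => Φ I a b +
          (2 * (eps n a * X a b)) * t + (∑ c, X c a * eps n c * X c b) * t ^ 2 := by
        ext t
        have e1 : ∑ c, (I + t • X) c a * eps n c * (I + t • X) c b =
            ∑ c, I c a * eps n c * I c b + t * (eps n a * X a b) + t * (eps n b * X b a) +
              (∑ c, X c a * eps n c * X c b) * t ^ 2 := by
          have : ∀ c, (I + t • X) c a * eps n c * (I + t • X) c b =
            I c a * eps n c * I c b + (if c = a then t * (eps n a * X a b) else 0) +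
             (if c = b then t * (eps n b * X b a) else 0) + X c a * eps n c * X c b * t ^ 2 := by
            intro c
            simp only [hap, I]
            by_cases h1 : c = a <;> by_cases h2 : c = b
            · subst h1; subst h2; simp; ring
            · subst h1; simp [h2]; ring
            · subst h2; simp [h1]; ring
            · simp [h1, h2]; ring
          simp only [this, Finset.sum_add_distrib, Finset.sum_mul, Finset.sum_ite_eq',
            Finset.mem_univ, if_true]
        simp only [Φ]
        rw [e1, hap, hap]
        ring
      rw [this]
      have d1 := ((hasDerivAt_id (0 : ℝ)).const_mul (2 * (eps n a * X a b))).const_add (Φ I a b)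
      have d2 := (hasDerivAt_pow 2 (0 : ℝ)).const_mul (∑ c, X c a * eps n c * X c b)
      have d := d1.add d2
      norm_num at d
      exact d
    exact h1.unique h2
  have hsurj : (fderiv ℝ Φ I).range = ⊤ := by
    refine LinearMap.range_eq_top.2 fun S => ⟨fun a b => (1 / 2) * (eps n a * S a b), ?_⟩
    change fderiv ℝ Φ I _ = S
    rw [hder]
    ext a b
    have := eps_mul_self n a
    linear_combination S a b * this
  have hmap := hstrict.map_nhds_eq_of_surj hsurj
  have hI : Φ I = minkM n := by
    ext a b
    by_cases h : a = b
    · subst h; simp [Φ, I, minkM]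
    · simp [Φ, I, minkM, h, Ne.symm h]
  have hopen : {M : Fin (n + 1) → Fin (n + 1) → ℝ | (Matrix.of M).det ≠ 0} ∈ nhds I := by
    have hc : Continuous fun M : Fin (n + 1) → Fin (n + 1) → ℝ => (Matrix.of M).det :=
      Continuous.matrix_det (continuous_id)
    refine (isOpen_ne.preimage hc).mem_nhds ?_
    change (Matrix.of I).det ≠ 0
    have : Matrix.of I = 1 := by
      ext a b; simp [I, Matrix.one_apply]
    simp [this]
  have himg := Filter.image_mem_map (m := Φ) hopen
  rw [hmap, hI] at himg
  obtain ⟨δ, hδ, hball⟩ := Metric.mem_nhds_iff.1 himg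
  refine ⟨δ, hδ, fun G hG hclose => ?_⟩
  obtain ⟨M, hM, hMG⟩ := hball (show G ∈ Metric.ball (minkM n) δ by
    rw [Metric.mem_ball, dist_pi_lt_iff hδ]
    intro a
    rw [dist_pi_lt_iff hδ]
    intro b
    exact hclose a b)
  have hM' : IsUnit (Matrix.of M).det := isUnit_iff_ne_zero.2 hM
  have key : ∀ a b, ∑ c, M c a * eps n c * M c b = G a b := by
    intro a b
    have h1 : Φ M a b = G a b := by rw [hMG]
    have h2 : Φ M b a = G b a := by rw [hMG]
    have h3 : ∑ c, M c b * eps n c * M c a = ∑ c, M c a * eps n c * M c b :=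
      Finset.sum_congr rfl fun c _ => by ring
    simp only [Φ, h3] at h1 h2
    have := hG a b
    linarith
  have hmat : (Matrix.of M)ᵀ * Matrix.of (minkM n) * Matrix.of M = Matrix.of G := by
    ext a b
    rw [Matrix.of_apply, ← key a b, Matrix.mul_apply]
    refine Finset.sum_congr rfl fun c _ => ?_
    simp [Matrix.mul_apply, minkM]
  refine ⟨(Matrix.of M)⁻¹, by rw [Matrix.det_nonsing_inv]; exact hM'.ringInverse, fun a b => ?_⟩
  have : ((Matrix.of M)⁻¹)ᵀ * Matrix.of G * (Matrix.of M)⁻¹ = Matrix.of (minkM n) := by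
    rw [← hmat, Matrix.transpose_nonsing_inv]
    have h1 : (Matrix.of M)ᵀ⁻¹ * (Matrix.of M)ᵀ = 1 :=
      Matrix.nonsing_inv_mul _ (by rwa [Matrix.det_transpose])
    have h2 : Matrix.of M * (Matrix.of M)⁻¹ = 1 := Matrix.mul_nonsing_inv _ hM'
    calc _ = (Matrix.of M)ᵀ⁻¹ * (Matrix.of M)ᵀ * Matrix.of (minkM n) *
          (Matrix.of M * (Matrix.of M)⁻¹) := by simp only [Matrix.mul_assoc]
      _ = _ := by rw [h1, h2, one_mul, mul_one]
  have h := congrFun (congrFun this a) b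
  rw [Matrix.of_apply] at h
  rw [← h, Matrix.mul_apply]
  simp only [Matrix.mul_apply, Matrix.transpose_apply, Matrix.of_apply, Finset.sum_mul]
  rw [Finset.sum_comm]

theorem hasFDerivAt_integral_param {E : Type*} [NormedAddCommGroup E] [NormedSpace ℝ E]
    [FiniteDimensional ℝ E] {G : E × ℝ → ℝ} (hG : ContDiff ℝ (⊤ : ℕ∞) G) (p : E) :
    HasFDerivAt (fun p => ∫ u in (0 : ℝ)..1, G (p, u))
      (∫ u in (0 : ℝ)..1, (fderiv ℝ G (p, u)).comp (ContinuousLinearMap.inl ℝ E ℝ)) p := by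
  have := FiniteDimensional.proper ℝ E
  have hD : Continuous fun q : E × ℝ =>
      (fderiv ℝ G q).comp (ContinuousLinearMap.inl ℝ E ℝ) :=
    (hG.continuous_fderiv (by simp)).clm_comp continuous_const
  have hGc := hG.continuous
  obtain ⟨C, hC⟩ := ((isCompact_closedBall p 1).prod (isCompact_Icc (a := (0 : ℝ))
    (b := 1))).exists_bound_of_continuousOn hD.continuousOn
  refine intervalIntegral.hasFDerivAt_integral_of_dominated_of_fderiv_le (bound := fun _ => C)
    (s := Metric.closedBall p 1) (Metric.closedBall_mem_nhds p one_pos)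
    (F' := fun p u => (fderiv ℝ G (p, u)).comp (ContinuousLinearMap.inl ℝ E ℝ))
    ?_ ?_ ?_ ?_ ?_ ?_
  · exact Filter.Eventually.of_forall fun q =>
      (hGc.comp (by fun_prop : Continuous fun u : ℝ => (q, u))).aestronglyMeasurable
  · exact (hGc.comp (by fun_prop : Continuous fun u : ℝ => (p, u))).intervalIntegrable _ _
  · exact (hD.comp (by fun_prop : Continuous fun u : ℝ => (p, u))).aestronglyMeasurable
  · refine Filter.Eventually.of_forall fun t ht q hq => hC (q, t) ⟨hq, ?_⟩
    rw [Set.uIoc_of_le zero_le_one] at ht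
    exact ⟨ht.1.le, ht.2⟩
  · exact intervalIntegrable_const
  · refine Filter.Eventually.of_forall fun t _ q _ => ?_
    have h1 : HasFDerivAt G (fderiv ℝ G (q, t)) (q, t) :=
      (hG.differentiable (by simp) _).hasFDerivAt
    have h2 : HasFDerivAt (fun x : E => (x, t)) (ContinuousLinearMap.inl ℝ E ℝ) q :=
      hasFDerivAt_prodMk_left q t
    exact h1.comp q h2

theorem contDiff_integral_param {E : Type*} [NormedAddCommGroup E] [NormedSpace ℝ E]
    [FiniteDimensional ℝ E] {G : E × ℝ → ℝ} (hG : ContDiff ℝ (⊤ : ℕ∞) G) :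
    ContDiff ℝ (⊤ : ℕ∞) (fun p => ∫ u in (0 : ℝ)..1, G (p, u)) := by
  refine contDiff_infty.2 fun m => ?_
  induction m generalizing G with
  | zero =>
    refine contDiff_zero.2 ?_
    exact intervalIntegral.continuous_parametric_intervalIntegral_of_continuous'
      (f := fun p u => G (p, u)) hG.continuous 0 1
  | succ m ih =>
    refine contDiff_succ_iff_fderiv_apply.2
      ⟨fun p => (hasFDerivAt_integral_param hG p).differentiableAt,
        fun h => absurd h (WithTop.natCast_ne_top m), fun y => ?_⟩
    have hD : ContDiff ℝ (⊤ : ℕ∞) fun q : E × ℝ => fderiv ℝ G q (y, 0) :=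
      (hG.fderiv_right (m := (⊤ : ℕ∞)) (by simp)).clm_apply contDiff_const
    have hDc : Continuous fun q : E × ℝ =>
        (fderiv ℝ G q).comp (ContinuousLinearMap.inl ℝ E ℝ) :=
      (hG.continuous_fderiv (by simp)).clm_comp continuous_const
    convert ih hD using 2 with p
    rw [(hasFDerivAt_integral_param hG p).fderiv, ContinuousLinearMap.intervalIntegral_apply]
    · rfl
    · exact (hDc.comp (by fun_prop : Continuous fun u : ℝ => (p, u))).intervalIntegrable _ _

/-- Smooth division: `f (s • x) = f 0 + s * K (s, x)`. -/
theorem exists_smooth_quotient {E : Type*} [NormedAddCommGroup E] [NormedSpace ℝ E]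
    [FiniteDimensional ℝ E] {f : E → ℝ} (hf : ContDiff ℝ (⊤ : ℕ∞) f) :
    ∃ K : ℝ × E → ℝ, ContDiff ℝ (⊤ : ℕ∞) K ∧ (∀ s x, f (s • x) = f 0 + s * K (s, x)) ∧
      (∀ x, K (0, x) = fderiv ℝ f 0 x) ∧ ∀ s t x, K (s, t • x) = t * K (t * s, x) := by
  refine ⟨fun p => ∫ u in (0 : ℝ)..1, fderiv ℝ f ((u * p.1) • p.2) p.2, ?_, ?_, ?_, ?_⟩
  · refine contDiff_integral_param
      (G := fun q : (ℝ × E) × ℝ => fderiv ℝ f ((q.2 * q.1.1) • q.1.2) q.1.2) ?_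
    have hD : ContDiff ℝ (⊤ : ℕ∞) (fderiv ℝ f) := hf.fderiv_right (m := (⊤ : ℕ∞)) (by simp)
    exact (hD.comp (by fun_prop)).clm_apply (by fun_prop)
  · intro s x
    have hd : ∀ u ∈ Set.uIcc (0 : ℝ) 1, HasDerivAt (fun u : ℝ => f ((u * s) • x))
        (s * fderiv ℝ f ((u * s) • x) x) u := by
      intro u _
      have h1 : HasFDerivAt f (fderiv ℝ f ((u * s) • x)) ((u * s) • x) :=
        (hf.differentiable (by simp) _).hasFDerivAt
      have h2 : HasDerivAt (fun u : ℝ => (u * s) • x) (s • x) u := by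
        simpa using ((hasDerivAt_id u).mul_const s).smul_const x
      have := h1.comp_hasDerivAt u h2
      rw [map_smul, smul_eq_mul] at this
      exact this
    have hc : Continuous fun u : ℝ => s * fderiv ℝ f ((u * s) • x) x :=
      continuous_const.mul (((hf.continuous_fderiv (by simp)).comp (by fun_prop)).clm_apply
        continuous_const)
    have := intervalIntegral.integral_eq_sub_of_hasDerivAt hd (hc.intervalIntegrable _ _)
    simp only [one_mul, zero_mul, zero_smul, intervalIntegral.integral_const_mul] at this
    linarith
  · intro x
    simp
  · intro s t x
    simp only [map_smul, smul_eq_mul, intervalIntegral.integral_const_mul, smul_smul]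
    congr 2
    ext u
    congr 3
    ring

theorem exists_cutoff {E : Type*} [NormedAddCommGroup E] [NormedSpace ℝ E]
    [FiniteDimensional ℝ E] {W : Set E} (hW : IsOpen W) {x : E} (hx : x ∈ W) :
    ∃ χ : E → ℝ, (∀ᶠ y in nhds x, χ y = 1) ∧ (∀ y ∉ W, χ y = 0) ∧
      ∀ f : E → ℝ, ContDiffOn ℝ (⊤ : ℕ∞) f W → ContDiff ℝ (⊤ : ℕ∞) fun y => χ y * f y := by
  obtain ⟨ε, hε, hball⟩ := Metric.isOpen_iff.1 hW x hx
  let χ : ContDiffBump x := ⟨ε / 4, ε / 2, by linarith, by linarith⟩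
  have hout : ∀ y, y ∉ Metric.closedBall x (ε / 2) → χ y = 0 := fun y hy => by
    apply χ.zero_of_le_dist
    rw [Metric.mem_closedBall, not_le] at hy
    exact hy.le
  have hsub : Metric.closedBall x (ε / 2) ⊆ W :=
    (Metric.closedBall_subset_ball (by linarith)).trans hball
  refine ⟨χ, χ.eventuallyEq_one, fun y hy => hout y fun h => hy (hsub h), fun f hf => ?_⟩
  refine contDiff_iff_contDiffAt.2 fun y => ?_
  by_cases hy : y ∈ W
  · exact χ.contDiff.contDiffAt.mul (hf.contDiffAt (hW.mem_nhds hy))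
  · have : (fun z => χ z * f z) =ᶠ[nhds y] fun _ => 0 := by
      filter_upwards [Metric.isClosed_closedBall.isOpen_compl.mem_nhds
        (show y ∈ (Metric.closedBall x (ε / 2))ᶜ from fun h => hy (hsub h))] with z hz
      rw [hout z hz, zero_mul]
    exact contDiffAt_const.congr_of_eventuallyEq this

theorem IsMetricOn.mono {n : ℕ} {W W' : Set (Pt n)} {g} (h : IsMetricOn n W g) (hs : W' ⊆ W) :
    IsMetricOn n W' g :=
  ⟨fun a b => (h.1 a b).mono hs, fun x hx => h.2 x (hs hx)⟩

theorem IsFormOn.mono {n k : ℕ} {W W' : Set (Pt n)} {ω} (h : IsFormOn n k W ω) (hs : W' ⊆ W) :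
    IsFormOn n k W' ω :=
  ⟨fun a => (h.1 a).mono hs, fun x hx => h.2 x (hs hx)⟩

theorem minkM_symm (n : ℕ) (a b : Fin (n + 1)) : minkM n a b = minkM n b a := by
  by_cases h : a = b
  · rw [h]
  · simp [minkM, h, Ne.symm h]

theorem isMetricOn_minkM (n : ℕ) (W : Set (Pt n)) : IsMetricOn n W fun _ => minkM n := by
  refine ⟨fun a b => contDiffOn_const, fun x _ => ⟨minkM_symm n, 1, by simp, fun a b => ?_⟩⟩
  simp [Matrix.one_apply]

theorem isFormOn_const {n k : ℕ} (W : Set (Pt n)) {w : (Fin k → Fin (n + 1)) → ℝ}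
    (hw : IsAlt w) : IsFormOn n k W fun _ => w :=
  ⟨fun _ => contDiffOn_const, fun _ _ => hw⟩

/-- Independence of the unit of scale. -/
def IsScaleInvariant {n k : ℕ} (T : NaturalTensor n k) : Prop :=
  ∀ W g ω, IsOpen W → IsMetricOn n W g → IsFormOn n k W ω →
      ∀ lam : ℝ, 0 < lam → ∀ x ∈ W, ∀ a b,
        T.T W (fun y c d => lam ^ 2 * g y c d) (fun y v => lam ^ (k - 1) * ω y v) x a b
          = T.T W g ω x a b

/-- Vanishing at the zeros of the form. -/
def VanishesAtZeros {n k : ℕ} (T : NaturalTensor n k) : Prop :=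
  ∀ W g ω, IsOpen W → IsMetricOn n W g → IsFormOn n k W ω →
      ∀ x ∈ W, (∀ v, ω x v = 0) → ∀ a b, T.T W g ω x a b = 0

theorem jac_smul (n : ℕ) (t : ℝ) (x : Pt n) (a c : Fin (n + 1)) :
    jac n (fun y => t • y) x a c = if a = c then t else 0 := by
  have : HasFDerivAt (fun y : Pt n => t • y) (t • ContinuousLinearMap.id ℝ (Pt n)) x :=
    (hasFDerivAt_id x).const_smul t
  rw [jac, this.fderiv]
  simp [Pi.single_apply, eq_comm]

theorem dilation {n k : ℕ} {T : NaturalTensor n k} (hT : IsScaleInvariant T) (hk : 1 ≤ k)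
    {t r : ℝ} (ht : 0 < t) (hr : 0 < r) {g ω}
    (hg : IsMetricOn n (Metric.ball 0 (t * r)) g) (hω : IsFormOn n k (Metric.ball 0 (t * r)) ω)
    (hg' : IsMetricOn n (Metric.ball 0 r) fun x => g (t • x))
    (hω' : IsFormOn n k (Metric.ball 0 r) fun x v => t * ω (t • x) v) (a b : Fin (n + 1)) :
    T.T (Metric.ball 0 r) (fun x => g (t • x)) (fun x v => t * ω (t • x) v) 0 a b =
      t ^ 2 * T.T (Metric.ball 0 (t * r)) g ω 0 a b := by
  have hdiff : IsDiffeoOn n (fun x => t • x) (fun x => t⁻¹ • x) (Metric.ball 0 r)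
      (Metric.ball 0 (t * r)) := by
    refine ⟨Metric.isOpen_ball, Metric.isOpen_ball, fun x hx => ?_, fun x hx => ?_,
      fun x _ => inv_smul_smul₀ ht.ne' x, fun x _ => smul_inv_smul₀ ht.ne' x,
      (contDiff_const_smul t).contDiffOn, (contDiff_const_smul t⁻¹).contDiffOn⟩
    · rw [mem_ball_zero_iff] at hx ⊢
      rw [norm_smul, Real.norm_of_nonneg ht.le]
      exact mul_lt_mul_of_pos_left hx ht
    · rw [mem_ball_zero_iff] at hx ⊢
      rw [norm_smul, norm_inv, Real.norm_of_nonneg ht.le]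
      rwa [inv_mul_lt_iff₀ ht]
  have h1 : pullTensor n (fun x => t • x) g = fun y c d => t ^ 2 * g (t • y) c d := by
    ext x c d
    simp only [pullTensor, jac_smul, ite_mul, mul_ite, zero_mul, mul_zero, Finset.sum_ite_eq,
      Finset.mem_univ, if_true]
    ring
  have h2 : pullForm n k (fun x => t • x) ω =
      fun y v => t ^ (k - 1) * (t * ω (t • y) v) := by
    ext x v
    simp only [pullForm, jac_smul]
    rw [Finset.sum_eq_single v]
    · obtain ⟨k, rfl⟩ : ∃ m, k = m + 1 := ⟨k - 1, by omega⟩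
      simp [pow_succ, mul_assoc]
    · intro w _ hw
      obtain ⟨j, hj⟩ := Function.ne_iff.1 hw
      rw [Finset.prod_eq_zero (Finset.mem_univ j) (by simp [hj.symm]), zero_mul]
    · simp
  have h3 := T.natural _ _ _ _ hdiff g ω hg hω 0 (Metric.mem_ball_self hr) a b
  rw [h1, h2, hT _ _ _ Metric.isOpen_ball hg' hω' t ht 0 (Metric.mem_ball_self hr)] at h3
  rw [h3]
  simp only [pullTensor, jac_smul, ite_mul, mul_ite, zero_mul, mul_zero, Finset.sum_ite_eq,
    Finset.mem_univ, if_true, smul_zero]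
  ring

theorem IsMetricOn.congr {n : ℕ} {W : Set (Pt n)} {g g'} (h : IsMetricOn n W g)
    (he : ∀ x ∈ W, g' x = g x) : IsMetricOn n W g' :=
  ⟨fun a b => (h.1 a b).congr fun x hx => by rw [he x hx],
    fun x hx => by rw [he x hx]; exact h.2 x hx⟩

theorem IsFormOn.congr {n k : ℕ} {W : Set (Pt n)} {ω ω'} (h : IsFormOn n k W ω)
    (he : ∀ x ∈ W, ω' x = ω x) : IsFormOn n k W ω' :=
  ⟨fun a => (h.1 a).congr fun x hx => by rw [he x hx],
    fun x hx => by rw [he x hx]; exact h.2 x hx⟩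

/-- At a point where the metric agrees with the Minkowski metric to first order, the tensor
depends on the value of the form only. -/
theorem eq_const_of_flat {n k : ℕ} {T : NaturalTensor n k} (hS : IsScaleInvariant T)
    (hV : VanishesAtZeros T) (hk : 1 ≤ k) {W : Set (Pt n)} {g ω} (hW : IsOpen W)
    (h0 : (0 : Pt n) ∈ W) (hg : IsMetricOn n W g) (hω : IsFormOn n k W ω)
    (g0 : ∀ c d, g 0 c d = minkM n c d) (dg : ∀ c d, fderiv ℝ (fun x => g x c d) 0 = 0)
    (a b : Fin (n + 1)) :
    T.T W g ω 0 a b = T.T Set.univ (fun _ => minkM n) (fun _ => ω 0) 0 a b := by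
  obtain ⟨χ, hχ1, hχ0, hχ⟩ := exists_cutoff hW h0
  obtain ⟨δ, hδ, hmink⟩ := exists_congruent_minkM n
  obtain ⟨ε, hε, hεW⟩ := Metric.mem_nhds_iff.1 (Filter.inter_mem hχ1 (hW.mem_nhds h0))
  have hχ_zero : χ 0 = 1 := (hεW (Metric.mem_ball_self hε)).1
  set h : Fin (n + 1) → Fin (n + 1) → Pt n → ℝ :=
    fun c d x => χ x * (g x c d - minkM n c d) with hh
  have hsm : ∀ c d, ContDiff ℝ (⊤ : ℕ∞) (h c d) := fun c d =>
    hχ _ ((hg.1 c d).sub contDiffOn_const)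
  have hsymm : ∀ c d, h c d = h d c := by
    intro c d
    ext x
    by_cases hx : x ∈ W
    · simp only [hh, (hg.2 x hx).1 c d, minkM_symm n c d]
    · simp only [hh, hχ0 x hx, zero_mul]
  have hh0 : ∀ c d, h c d 0 = 0 := fun c d => by simp [hh, g0]
  have hdh : ∀ c d, fderiv ℝ (h c d) 0 = 0 := by
    intro c d
    have : h c d =ᶠ[nhds 0] fun x => g x c d - minkM n c d := by
      filter_upwards [hχ1] with x hx
      simp [hh, hx]
    rw [this.fderiv_eq, fderiv_sub_const, dg]
  choose K hK1 hK2 hK3 hK4 using fun c d => exists_smooth_quotient (hsm c d)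
  set S : Fin (n + 1) → Fin (n + 1) → ℝ × Pt n → ℝ :=
    fun c d p => (K c d p + K d c p) / 2 with hSdef
  have S1 : ∀ c d, ContDiff ℝ (⊤ : ℕ∞) (S c d) := fun c d =>
    ((hK1 c d).add (hK1 d c)).div_const 2
  have S2 : ∀ c d s x, h c d (s • x) = s * S c d (s, x) := by
    intro c d s x
    have e1 := hK2 c d s x
    have e2 := hK2 d c s x
    rw [hsymm d c] at e2
    simp only [hSdef, hh0] at e1 e2 ⊢
    linarith
  have S3 : ∀ c d x, S c d (0, x) = 0 := by
    intro c d x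
    simp [hSdef, hK3, hdh]
  have S4 : ∀ c d s t x, S c d (s, t • x) = t * S c d (t * s, x) := by
    intro c d s t x
    simp only [hSdef, hK4]
    ring
  have S5 : ∀ c d p, S c d p = S d c p := fun c d p => by
    simp only [hSdef, add_comm]
  have Scont : Continuous fun p => fun c d => S c d p :=
    continuous_pi fun c => continuous_pi fun d => (S1 c d).continuous
  obtain ⟨C, hC⟩ := ((isCompact_closedBall (0 : ℝ) 1).prod
    (isCompact_closedBall (0 : Pt n) 1)).exists_bound_of_continuousOn Scont.continuousOn
  set ωt : Pt n → (Fin k → Fin (n + 1)) → ℝ := fun x v => χ x * ω x v with hωt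
  have ωsm : ∀ v, ContDiff ℝ (⊤ : ℕ∞) fun x => ωt x v := fun v => hχ _ (hω.1 v)
  have ωalt : ∀ x, IsAlt (ωt x) := by
    intro x v σ
    by_cases hx : x ∈ W
    · simp only [hωt, hω.2 x hx v σ]; ring
    · simp only [hωt, hχ0 x hx, zero_mul, mul_zero]
  have ω0 : ωt 0 = ω 0 := by ext v; simp [hωt, hχ_zero]
  set gt : Pt n → Fin (n + 1) → Fin (n + 1) → ℝ := fun x c d => minkM n c d + h c d x with hgt
  have gt_eq : ∀ x ∈ Metric.ball (0 : Pt n) ε, gt x = g x := by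
    intro x hx
    ext c d
    have : χ x = 1 := (hεW hx).1
    simp [hgt, hh, this]
  have ωt_eq : ∀ x ∈ Metric.ball (0 : Pt n) ε, ωt x = ω x := by
    intro x hx
    ext v
    have : χ x = 1 := (hεW hx).1
    simp [hωt, this]
  set γ : (Fin 4 → ℝ) → Pt n → Fin (n + 1) → Fin (n + 1) → ℝ :=
    fun q x c d => minkM n c d + q 1 * S c d (q 0, x) with hγ
  set F : (Fin 4 → ℝ) → Pt n → (Fin k → Fin (n + 1)) → ℝ :=
    fun q x v => q 2 * ωt 0 v + q 3 * (ωt (q 0 • x) v - ωt 0 v) with hF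
  set ρ : ℝ := min 1 (min ε (δ / (|C| + 1))) with hρdef
  have hρ : 0 < ρ := by positivity
  have hρ1 : ρ ≤ 1 := min_le_left _ _
  have hρε : ρ ≤ ε := (min_le_right _ _).trans (min_le_left _ _)
  have hρδ : ρ * (|C| + 1) ≤ δ := by
    rw [← le_div_iff₀ (by positivity)]
    exact (min_le_right _ _).trans (min_le_right _ _)
  set W0 : Set (Pt n) := Metric.ball 0 1 with hW0
  set P : Set (Fin 4 → ℝ) := Metric.ball 0 ρ with hP
  have hcoord : ∀ q ∈ P, ∀ i, |q i| < ρ := by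
    intro q hq i
    rw [hP, mem_ball_zero_iff] at hq
    exact (norm_le_pi_norm q i).trans_lt hq
  have γsm : ∀ c d, ContDiff ℝ (⊤ : ℕ∞) fun p : (Fin 4 → ℝ) × Pt n => γ p.1 p.2 c d := by
    intro c d
    refine contDiff_const.add (ContDiff.mul (by fun_prop) ((S1 c d).comp ?_))
    fun_prop
  have Fsm : ∀ v, ContDiff ℝ (⊤ : ℕ∞) fun p : (Fin 4 → ℝ) × Pt n => F p.1 p.2 v := by
    intro v
    have : ContDiff ℝ (⊤ : ℕ∞) fun p : (Fin 4 → ℝ) × Pt n => ωt (p.1 0 • p.2) v :=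
      (ωsm v).comp (by fun_prop)
    exact ContDiff.add (by fun_prop) (ContDiff.mul (by fun_prop) (this.sub contDiff_const))
  have γmet : ∀ q ∈ P, IsMetricOn n W0 (γ q) := by
    intro q hq
    refine ⟨fun c d => ((γsm c d).comp (by fun_prop : ContDiff ℝ (⊤ : ℕ∞)
      fun x : Pt n => (q, x))).contDiffOn, fun x hx => ?_⟩
    have hs : ∀ c d, γ q x c d = γ q x d c := fun c d => by
      simp only [hγ, minkM_symm n c d, S5 c d]
    refine ⟨hs, hmink _ hs fun c d => ?_⟩
    have hq0 := hcoord q hq 0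
    have hq1 := hcoord q hq 1
    have hb := hC (q 0, x) ⟨by
      rw [mem_closedBall_zero_iff, Real.norm_eq_abs]; linarith, Metric.ball_subset_closedBall hx⟩
    have hb' : |S c d (q 0, x)| ≤ |C| :=
      ((norm_le_pi_norm (fun d => S c d (q 0, x)) d).trans
        (norm_le_pi_norm (fun c d => S c d (q 0, x)) c)).trans (hb.trans (le_abs_self C))
    simp only [hγ, add_sub_cancel_left, abs_mul]
    calc |q 1| * |S c d (q 0, x)| ≤ |q 1| * |C| := by gcongr
      _ ≤ ρ * |C| := by gcongr
      _ < ρ * (|C| + 1) := by gcongr; linarith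
      _ ≤ δ := hρδ
  have Fform : ∀ q, IsFormOn n k W0 (F q) := by
    intro q
    refine ⟨fun v => ((Fsm v).comp (by fun_prop : ContDiff ℝ (⊤ : ℕ∞)
      fun x : Pt n => (q, x))).contDiffOn, fun x _ v σ => ?_⟩
    simp only [hF, ωalt _ v σ]
    ring
  set Φ : (Fin 4 → ℝ) → ℝ := fun q => T.T W0 (γ q) (F q) 0 a b with hΦ
  have hW0o : IsOpen W0 := Metric.isOpen_ball
  have h0W0 : (0 : Pt n) ∈ W0 := Metric.mem_ball_self one_pos
  have Φsm : ContDiffOn ℝ (⊤ : ℕ∞) Φ P := by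
    have := T.regular 4 P W0 Metric.isOpen_ball hW0o γ F (fun c d => (γsm c d).contDiffOn)
      (fun v => (Fsm v).contDiffOn) (fun q hq => ⟨γmet q hq, Fform q⟩) a b
    exact this.comp (by fun_prop : ContDiff ℝ (⊤ : ℕ∞) fun q : Fin 4 → ℝ =>
      (q, (0 : Pt n))).contDiffOn fun q hq => ⟨hq, h0W0⟩
  have Φhom : ∀ q ∈ P, ∀ t : ℝ, 0 < t → t ≤ 1 → t • q ∈ P ∧ Φ (t • q) = t ^ 2 * Φ q := by
    intro q hq t ht ht1
    have htq : t • q ∈ P := by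
      rw [hP, mem_ball_zero_iff] at hq ⊢
      rw [norm_smul, Real.norm_of_nonneg ht.le]
      exact (mul_le_of_le_one_left (norm_nonneg q) ht1).trans_lt hq
    refine ⟨htq, ?_⟩
    have e1 : γ (t • q) = fun x => γ q (t • x) := by
      ext x c d
      simp only [hγ, S4, Pi.smul_apply, smul_eq_mul]
      ring
    have e2 : F (t • q) = fun x v => t * F q (t • x) v := by
      ext x v
      simp only [hF, Pi.smul_apply, smul_eq_mul, smul_smul, mul_comm t (q 0)]
      ring
    have hsub : Metric.ball (0 : Pt n) (t * 1) ⊆ W0 :=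
      Metric.ball_subset_ball (by linarith)
    have := dilation hS hk ht one_pos ((γmet q hq).mono hsub) ((Fform q).mono hsub)
      (e1 ▸ γmet _ htq) (e2 ▸ Fform (t • q)) a b
    simp only [hΦ]
    rw [e1, e2, this, T.localize _ W0 _ _ _ _ Metric.isOpen_ball hW0o hsub
      ((γmet q hq).mono hsub) ((Fform q).mono hsub) (γmet q hq) (Fform q)
      (fun _ _ => ⟨rfl, rfl⟩) 0 (Metric.mem_ball_self (by linarith))]
  obtain ⟨B, Bsymm, hB⟩ := exists_bilin_of_homogeneous Metric.isOpen_ball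
    (Metric.mem_ball_self hρ) Φsm Φhom
  set r := ρ / 2 with hr
  have hr0 : 0 < r := by positivity
  have hmem : ∀ q : Fin 4 → ℝ, (∀ i, |q i| ≤ 1) → r • q ∈ P := by
    intro q hq
    rw [hP, mem_ball_zero_iff, pi_norm_lt_iff hρ]
    intro i
    rw [Pi.smul_apply, smul_eq_mul, norm_mul, Real.norm_of_nonneg hr0.le, Real.norm_eq_abs]
    have := mul_le_of_le_one_right hr0.le (hq i)
    linarith
  have hΦB : ∀ q : Fin 4 → ℝ, (∀ i, |q i| ≤ 1) → Φ (r • q) = r ^ 2 * B q q := by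
    intro q hq
    rw [hB _ (hmem q hq)]
    simp only [map_smul, LinearMap.smul_apply, smul_eq_mul]
    ring
  have hr2 : r ^ 2 ≠ 0 := by positivity
  have Bzero : ∀ q : Fin 4 → ℝ, (∀ i, |q i| ≤ 1) → q 2 = 0 → B q q = 0 := by
    intro q hq hq2
    apply mul_left_cancel₀ hr2
    rw [← hΦB q hq, mul_zero]
    refine hV _ _ _ hW0o (γmet _ (hmem q hq)) (Fform _) 0 h0W0 (fun v => ?_) a b
    simp [hF, hq2]
  have Bsame : ∀ q q' : Fin 4 → ℝ, (∀ i, |q i| ≤ 1) → (∀ i, |q' i| ≤ 1) →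
      γ (r • q) = γ (r • q') → F (r • q) = F (r • q') → B q q = B q' q' := by
    intro q q' hq hq' e1 e2
    apply mul_left_cancel₀ hr2
    rw [← hΦB q hq, ← hΦB q' hq']
    simp only [hΦ, e1, e2]
  have hγ0 : ∀ q : Fin 4 → ℝ, q 0 = 0 ∨ q 1 = 0 → γ (r • q) = fun _ => minkM n := by
    intro q hq
    ext x c d
    rcases hq with hq | hq <;> simp [hγ, hq, S3]
  have hF0 : ∀ q : Fin 4 → ℝ, q 0 = 0 ∨ q 3 = 0 → F (r • q) = fun _ v => r * q 2 * ω 0 v := by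
    intro q hq
    ext x v
    rcases hq with hq | hq <;> simp [hF, hq, ω0]
  let e : Fin 4 → Fin 4 → ℝ := fun i => Pi.single i 1
  have he : ∀ i j, |e i j| ≤ 1 := by
    intro i j
    simp only [e, Pi.single_apply]
    split_ifs <;> simp
  have he2 : ∀ i ≠ (2 : Fin 4), ∀ j, |(e i + e 2) j| ≤ 1 := by
    intro i hi j
    simp only [e, Pi.add_apply, Pi.single_apply]
    split_ifs with h1 h2
    · exact absurd (h1.symm.trans h2) hi
    all_goals norm_num
  have Bcross : ∀ i ≠ (2 : Fin 4), B (e i) (e 2) = 0 := by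
    intro i hi
    have h1 : B (e i) (e i) = 0 := Bzero _ (he i) (by simp [e, hi.symm])
    have h2 : B (e i + e 2) (e i + e 2) = B (e 2) (e 2) := by
      refine Bsame _ _ (he2 i hi) (he 2) ?_ ?_
      · rw [hγ0, hγ0]
        · simp [e]
        · by_cases h : i = 0
          · subst h; simp [e]
          · simp [e, Ne.symm h]
      · rw [hF0, hF0]
        · simp [e, hi.symm]
        · simp [e]
        · by_cases h : i = 0
          · subst h; simp [e]
          · simp [e, Ne.symm h]
    simp only [map_add, LinearMap.add_apply, h1, Bsymm (e 2) (e i)] at h2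
    linarith
  have hone : (fun _ => 1 : Fin 4 → ℝ) = e 0 + e 1 + e 3 + e 2 := by
    ext i
    fin_cases i <;> simp [e]
  have hv : B (e 0 + e 1 + e 3) (e 0 + e 1 + e 3) = 0 := by
    refine Bzero _ (fun i => ?_) (by simp [e])
    fin_cases i <;> simp [e]
  have hfin : B (fun _ => 1) (fun _ => 1) = B (e 2) (e 2) := by
    have h1 : B (e 0 + e 1 + e 3) (e 2) = 0 := by
      simp [Bcross]
    have h2 : ∀ x y, B (x + y) (x + y) = B x x + B x y + (B y x + B y y) := fun x y => by
      rw [map_add, map_add, LinearMap.add_apply, LinearMap.add_apply]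
      ring
    rw [hone, h2, hv, Bsymm (e 2) (e 0 + e 1 + e 3), h1]
    ring
  have hA : Φ (r • fun _ => 1) = Φ (r • e 2) := by
    rw [hΦB _ (by simp), hΦB _ (he 2), hfin]
  have hsub : Metric.ball (0 : Pt n) (r * 1) ⊆ Metric.ball 0 ε :=
    Metric.ball_subset_ball (by linarith)
  have hsubW : Metric.ball (0 : Pt n) (r * 1) ⊆ W := fun x hx => (hεW (hsub hx)).2
  have hL : Φ (r • fun _ => 1) = r ^ 2 * T.T W g ω 0 a b := by
    have e1 : γ (r • fun _ => 1) = fun x => gt (r • x) := by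
      ext x c d
      simp [hγ, hgt, S2]
    have e2 : F (r • fun _ => 1) = fun x v => r * ωt (r • x) v := by
      ext x v
      simp only [hF, Pi.smul_apply, smul_eq_mul, mul_one]
      ring
    have m1 : IsMetricOn n (Metric.ball 0 (r * 1)) gt :=
      (hg.mono hsubW).congr fun x hx => gt_eq x (hsub hx)
    have m2 : IsFormOn n k (Metric.ball 0 (r * 1)) ωt :=
      (hω.mono hsubW).congr fun x hx => ωt_eq x (hsub hx)
    have := dilation hS hk hr0 one_pos m1 m2 (e1 ▸ γmet _ (hmem (fun _ => 1) (by simp)))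
      (e2 ▸ Fform _) a b
    simp only [hΦ]
    rw [e1, e2, this, T.localize _ W _ _ _ _ Metric.isOpen_ball hW hsubW m1 m2 hg hω
      (fun x hx => ⟨gt_eq x (hsub hx), ωt_eq x (hsub hx)⟩) 0 (Metric.mem_ball_self (by linarith))]
  have hR : Φ (r • e 2) = r ^ 2 * T.T Set.univ (fun _ => minkM n) (fun _ => ω 0) 0 a b := by
    have e1 : γ (r • e 2) = fun x => (fun _ => minkM n) (r • x) := hγ0 _ (by simp [e])
    have e2 : F (r • e 2) = fun x v => r * (fun _ => ω 0) (r • x) v := by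
      rw [hF0 _ (by simp [e])]
      ext x v
      simp [e]
    have hω0 : IsAlt (ω 0) := hω.2 0 h0
    have := dilation hS hk hr0 one_pos (isMetricOn_minkM n _) (isFormOn_const _ hω0)
      (e1 ▸ γmet _ (hmem (e 2) (he 2))) (e2 ▸ Fform _) a b
    simp only [hΦ]
    rw [e1, e2, this, T.localize _ Set.univ _ _ _ _ Metric.isOpen_ball isOpen_univ
      (Set.subset_univ _) (isMetricOn_minkM n _) (isFormOn_const _ hω0) (isMetricOn_minkM n _)
      (isFormOn_const _ hω0) (fun _ _ => ⟨rfl, rfl⟩) 0 (Metric.mem_ball_self (by linarith))]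
  rw [hL, hR] at hA
  exact mul_left_cancel₀ hr2 hA

theorem IsDiffeoOn.jac_mul {n : ℕ} {τ σf : Pt n → Pt n} {U U' : Set (Pt n)}
    (h : IsDiffeoOn n τ σf U U') {y : Pt n} (hy : y ∈ U) :
    Matrix.of (jac n τ y) * Matrix.of (jac n σf (τ y)) = 1 := by
  have h1 : DifferentiableAt ℝ τ y :=
    (h.smooth.contDiffAt (h.open_src.mem_nhds hy)).differentiableAt (by simp)
  have h2 : DifferentiableAt ℝ σf (τ y) :=
    (h.smooth_inv.contDiffAt (h.open_tgt.mem_nhds (h.mapsTo hy))).differentiableAt (by simp)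
  have h3 : (fderiv ℝ σf (τ y)).comp (fderiv ℝ τ y) = ContinuousLinearMap.id ℝ (Pt n) := by
    rw [← fderiv_comp y h2 h1]
    have : σf ∘ τ =ᶠ[nhds y] id := by
      filter_upwards [h.open_src.mem_nhds hy] with z hz using h.left_inv z hz
    rw [this.fderiv_eq, fderiv_id]
  ext a b
  have h4 := congrFun (congrArg (fun L : Pt n →L[ℝ] Pt n => L (Pi.single a 1)) h3) b
  have h5 : fderiv ℝ τ y (Pi.single a 1) =
      ∑ c, jac n τ y a c • (Pi.single c 1 : Pt n) := by
    ext d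
    simp [jac, Pi.single_apply]
  rw [ContinuousLinearMap.comp_apply, h5, map_sum] at h4
  simp only [map_smul, Finset.sum_apply, Pi.smul_apply, smul_eq_mul] at h4
  rw [Matrix.mul_apply]
  simp only [Matrix.of_apply]
  refine h4.trans ?_
  simp [Matrix.one_apply, Pi.single_apply, eq_comm]

theorem IsDiffeoOn.isUnit_jac {n : ℕ} {τ σf : Pt n → Pt n} {U U' : Set (Pt n)}
    (h : IsDiffeoOn n τ σf U U') {y : Pt n} (hy : y ∈ U) :
    IsUnit (Matrix.of (jac n τ y)).det :=
  Matrix.isUnit_det_of_right_inverse (h.jac_mul hy)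

theorem IsDiffeoOn.contDiffOn_jac {n : ℕ} {τ σf : Pt n → Pt n} {U U' : Set (Pt n)}
    (h : IsDiffeoOn n τ σf U U') (a c : Fin (n + 1)) :
    ContDiffOn ℝ (⊤ : ℕ∞) (fun y => jac n τ y a c) U := by
  have h1 : ContDiffOn ℝ (⊤ : ℕ∞) (fderiv ℝ τ) U :=
    h.smooth.fderiv_of_isOpen h.open_src (by simp)
  have h2 := h1.clm_apply (contDiffOn_const (c := (Pi.single a 1 : Pt n)))
  exact (contDiff_apply ℝ ℝ c).comp_contDiffOn h2

theorem pullTensor_eq (n : ℕ) (τ : Pt n → Pt n) (g) (x : Pt n) (a b : Fin (n + 1)) :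
    pullTensor n τ g x a b =
      (Matrix.of (jac n τ x) * Matrix.of (g (τ x)) * (Matrix.of (jac n τ x))ᵀ) a b := by
  rw [conj_apply]; rfl

theorem IsDiffeoOn.isMetricOn {n : ℕ} {τ σf : Pt n → Pt n} {U U' : Set (Pt n)}
    (h : IsDiffeoOn n τ σf U U') {g} (hg : IsMetricOn n U' g) :
    IsMetricOn n U (pullTensor n τ g) := by
  refine ⟨fun a b => ?_, fun x hx => ⟨fun a b => ?_, ?_⟩⟩
  · refine ContDiffOn.sum fun c _ => ContDiffOn.sum fun d _ => ?_
    exact ((h.contDiffOn_jac a c).mul (h.contDiffOn_jac b d)).mul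
      ((hg.1 c d).comp h.smooth h.mapsTo)
  · simp only [pullTensor]
    rw [Finset.sum_comm]
    refine Finset.sum_congr rfl fun c _ => Finset.sum_congr rfl fun d _ => ?_
    rw [(hg.2 _ (h.mapsTo hx)).1 d c]; ring
  · obtain ⟨P, hP, hPg⟩ := (hg.2 _ (h.mapsTo hx)).2
    have hJ := h.isUnit_jac hx
    set J := Matrix.of (jac n τ x)
    have hconj : ∀ (P G : Matrix (Fin (n + 1)) (Fin (n + 1)) ℝ) a b,
        (∑ c, ∑ d, P c a * G c d * P d b) = (Pᵀ * G * P) a b := by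
      intro P G a b
      simp only [Matrix.mul_apply, Matrix.transpose_apply, Finset.sum_mul]
      exact Finset.sum_comm
    refine ⟨(J⁻¹)ᵀ * P, ?_, fun a b => ?_⟩
    · rw [Matrix.det_mul, Matrix.det_transpose]
      exact (Matrix.isUnit_nonsing_inv_det _ hJ).mul hP
    · have e1 : pullTensor n τ g x = (J * Matrix.of (g (τ x)) * Jᵀ :) := by
        ext a b; exact pullTensor_eq n τ g x a b
      rw [e1, hconj, ← hPg]
      refine Eq.trans ?_ (hconj P (Matrix.of (g (τ x))) a b).symm
      have h1 : J⁻¹ * J = 1 := Matrix.nonsing_inv_mul _ hJ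
      have h2 : Jᵀ * (J⁻¹)ᵀ = 1 := by rw [← Matrix.transpose_mul, h1, Matrix.transpose_one]
      have : ((J⁻¹)ᵀ * P)ᵀ * (J * Matrix.of (g (τ x)) * Jᵀ) * ((J⁻¹)ᵀ * P) =
          Pᵀ * (J⁻¹ * J) * Matrix.of (g (τ x)) * (Jᵀ * (J⁻¹)ᵀ) * P := by
        simp only [Matrix.transpose_mul, Matrix.transpose_transpose, Matrix.mul_assoc]
      rw [this, h1, h2, Matrix.mul_one, Matrix.mul_one]

theorem IsDiffeoOn.isFormOn {n k : ℕ} {τ σf : Pt n → Pt n} {U U' : Set (Pt n)}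
    (h : IsDiffeoOn n τ σf U U') {ω} (hω : IsFormOn n k U' ω) :
    IsFormOn n k U (pullForm n k τ ω) := by
  refine ⟨fun v => ?_, fun x hx => ?_⟩
  · refine ContDiffOn.sum fun w _ => ?_
    exact (contDiffOn_prod fun j _ => h.contDiffOn_jac _ _).mul
      ((hω.1 w).comp h.smooth h.mapsTo)
  · exact IsAlt.pullF (P := Matrix.of (jac n τ x)) (hω.2 _ (h.mapsTo hx))

/-- Naturality with respect to a diffeomorphism onto an open subset of the domain. -/
theorem NaturalTensor.pull {n k : ℕ} (T : NaturalTensor n k) {τ σf : Pt n → Pt n}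
    {U U' W : Set (Pt n)} (h : IsDiffeoOn n τ σf U U') (hW : IsOpen W) (hU : U' ⊆ W) {g ω}
    (hg : IsMetricOn n W g) (hω : IsFormOn n k W ω) {y : Pt n} (hy : y ∈ U)
    (a b : Fin (n + 1)) :
    T.T U (pullTensor n τ g) (pullForm n k τ ω) y a b =
      ∑ c, ∑ d, jac n τ y a c * jac n τ y b d * T.T W g ω (τ y) c d := by
  rw [T.natural τ σf U U' h g ω (hg.mono hU) (hω.mono hU) y hy a b, pullTensor,
    T.localize U' W g ω g ω h.open_tgt hW hU (hg.mono hU) (hω.mono hU) hg hω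
      (fun _ _ => ⟨rfl, rfl⟩) _ (h.mapsTo hy)]

theorem eq_zero_of_conj {ι : Type*} [Fintype ι] [DecidableEq ι] {J X : Matrix ι ι ℝ}
    (hJ : IsUnit J.det) (h : ∀ a b, ∑ c, ∑ d, J a c * J b d * X c d = 0) : X = 0 := by
  have h0 : J * X * Jᵀ = 0 := by ext a b; rw [conj_apply, h]; rfl
  have h1 : J⁻¹ * J = 1 := Matrix.nonsing_inv_mul _ hJ
  have h2 : Jᵀ * (J⁻¹)ᵀ = 1 := by rw [← Matrix.transpose_mul, h1, Matrix.transpose_one]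
  calc X = (J⁻¹ * J) * X * (Jᵀ * (J⁻¹)ᵀ) := by rw [h1, h2, Matrix.one_mul, Matrix.mul_one]
    _ = J⁻¹ * (J * X * Jᵀ) * (J⁻¹)ᵀ := by simp only [Matrix.mul_assoc]
    _ = 0 := by rw [h0]; simp

theorem exists_local_diffeo {n : ℕ} {τ : Pt n → Pt n} (hτ : ContDiff ℝ (⊤ : ℕ∞) τ)
    {e : Pt n ≃L[ℝ] Pt n} (he : HasFDerivAt τ (e : Pt n →L[ℝ] Pt n) 0) {W : Set (Pt n)}
    (hW : IsOpen W) (h0 : τ 0 ∈ W) :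
    ∃ σf U U', IsDiffeoOn n τ σf U U' ∧ 0 ∈ U ∧ U' ⊆ W := by
  set φ := hτ.contDiffAt.toOpenPartialHomeomorph τ he (by simp) with hφ
  have hφτ : ∀ y, φ y = τ y := fun _ => rfl
  set I : Set (Pt n) := {y | fderiv ℝ τ y ∈
    Set.range ((↑) : (Pt n ≃L[ℝ] Pt n) → Pt n →L[ℝ] Pt n)} with hI
  have hIo : IsOpen I :=
    ContinuousLinearEquiv.isOpen.preimage (hτ.continuous_fderiv (by simp))
  set U : Set (Pt n) := φ.source ∩ (I ∩ τ ⁻¹' W) with hU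
  have hUo : IsOpen U := φ.open_source.inter (hIo.inter (hW.preimage hτ.continuous))
  have hUs : U ⊆ φ.source := Set.inter_subset_left
  refine ⟨φ.symm, U, φ '' U, ⟨hUo, φ.isOpen_image_of_subset_source hUo hUs,
    fun y hy => ⟨y, hy, rfl⟩, ?_, fun x hx => φ.left_inv (hUs hx), ?_, hτ.contDiffOn, ?_⟩,
    ⟨hτ.contDiffAt.mem_toOpenPartialHomeomorph_source he (by simp), ⟨e, he.fderiv.symm⟩, h0⟩, ?_⟩
  · rintro _ ⟨y, hy, rfl⟩
    rwa [φ.left_inv (hUs hy)]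
  · rintro _ ⟨y, hy, rfl⟩
    exact φ.right_inv (φ.map_source (hUs hy))
  · rintro _ ⟨y, hy, rfl⟩
    obtain ⟨e', he'⟩ := hy.2.1
    have h1 : HasFDerivAt φ (e' : Pt n →L[ℝ] Pt n) (φ.symm (φ y)) := by
      rw [φ.left_inv (hUs hy), he']
      exact (hτ.differentiable (by simp) y).hasFDerivAt
    exact (φ.contDiffAt_symm (φ.map_source (hUs hy)) h1 hτ.contDiffAt).contDiffWithinAt
  · rintro _ ⟨y, hy, rfl⟩
    exact hy.2.2

theorem hasFDerivAt_quadratic {ι : Type*} [Fintype ι] [DecidableEq ι] (x : ℝ) (p : ι → ℝ)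
    {L : ι → ι → ℝ} (hL : ∀ d e, L d e = L e d) (y : ι → ℝ) :
    HasFDerivAt (fun y : ι → ℝ => x + ∑ a, p a * y a + 1 / 2 * ∑ d, ∑ e, L d e * (y d * y e))
      (∑ a, (p a + ∑ e, L a e * y e) • ContinuousLinearMap.proj (R := ℝ) (φ := fun _ => ℝ) a)
      y := by
  have hp : ∀ a : ι, HasFDerivAt (fun y : ι → ℝ => y a)
      (ContinuousLinearMap.proj (R := ℝ) (φ := fun _ => ℝ) a) y := fun a => hasFDerivAt_apply a y
  have h1 := (HasFDerivAt.fun_sum (u := Finset.univ) fun a _ => (hp a).const_mul (p a)).const_add x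
  have h2 := (HasFDerivAt.fun_sum (u := Finset.univ) fun d _ =>
    HasFDerivAt.fun_sum (u := Finset.univ) fun e _ =>
      ((hp d).mul (hp e)).const_mul (L d e)).const_mul (1 / 2 : ℝ)
  refine (h1.add h2).congr_fderiv ?_
  ext v
  simp only [add_apply, sum_apply,
    smul_apply, ContinuousLinearMap.proj_apply, smul_eq_mul, add_mul,
    Finset.sum_add_distrib, mul_add, Finset.sum_mul]
  have h3 : ∑ d, ∑ e, L d e * (y d * v e) = ∑ d, ∑ e, L d e * (y e * v d) := by
    rw [Finset.sum_comm]
    exact Finset.sum_congr rfl fun d _ => Finset.sum_congr rfl fun e _ => by rw [hL]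
  rw [h3]
  simp only [mul_assoc]
  ring

/-- Coordinates in which the metric agrees with the Minkowski metric to first order at a
point. -/
theorem exists_normal_coordinates {n : ℕ} {W : Set (Pt n)} (hW : IsOpen W) {g}
    (hg : IsMetricOn n W g) {x : Pt n} (hx : x ∈ W) :
    ∃ τ σf U U', IsDiffeoOn n τ σf U U' ∧ 0 ∈ U ∧ U' ⊆ W ∧ τ 0 = x ∧
      (∀ a b, pullTensor n τ g 0 a b = minkM n a b) ∧
      ∀ a b, fderiv ℝ (fun y => pullTensor n τ g y a b) 0 = 0 := by
  obtain ⟨hsymm, P, hP, hPg⟩ := hg.2 x hx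
  set D : Fin (n + 1) → Fin (n + 1) → Fin (n + 1) → ℝ :=
    fun c d e => fderiv ℝ (fun y => g y c d) x fun f => P f e with hD
  have Dsymm : ∀ c d e, D c d e = D d c e := by
    intro c d e
    have : (fun y => g y c d) =ᶠ[nhds x] fun y => g y d c := by
      filter_upwards [hW.mem_nhds hx] with y hy using (hg.2 y hy).1 c d
    simp only [hD, this.fderiv_eq]
  set G : Fin (n + 1) → Fin (n + 1) → Fin (n + 1) → ℝ :=
    fun a b e => ∑ c, ∑ d, P c a * P d b * D c d e with hG
  have Gsymm : ∀ a b e, G a b e = G b a e := by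
    intro a b e
    simp only [hG]
    rw [Finset.sum_comm]
    refine Finset.sum_congr rfl fun c _ => Finset.sum_congr rfl fun d _ => ?_
    rw [Dsymm]; ring
  set M : Fin (n + 1) → Fin (n + 1) → Fin (n + 1) → ℝ :=
    fun b a e => -(1 / 2) * (G b a e + G b e a - G a e b) with hM
  set L : Fin (n + 1) → Fin (n + 1) → Fin (n + 1) → ℝ :=
    fun c a e => ∑ b, P c b * (eps n b * M b a e) with hL
  have Lsymm : ∀ c a e, L c a e = L c e a := by
    intro c a e
    refine Finset.sum_congr rfl fun b _ => ?_
    simp only [hM, Gsymm a e]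
    ring
  have hLP : ∀ a b e, ∑ c, ∑ d, L c a e * P d b * g x c d = M b a e := by
    intro a b e
    have h1 : ∑ c, ∑ d, L c a e * P d b * g x c d =
        ∑ b', eps n b' * M b' a e * ∑ c, ∑ d, P c b' * g x c d * P d b := by
      simp only [hL, Finset.mul_sum, Finset.sum_mul]
      simp_rw [Finset.sum_comm (γ := Fin (n + 1)) (s := Finset.univ) (t := Finset.univ)
        (f := fun d b' => P _ b' * (eps n b' * M b' a e) * P d b * g x _ d)]
      rw [Finset.sum_comm]
      refine Finset.sum_congr rfl fun b' _ => Finset.sum_congr rfl fun c _ =>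
        Finset.sum_congr rfl fun d _ => ?_
      ring
    rw [h1]
    simp only [hPg]
    rw [Finset.sum_eq_single b]
    · have := eps_mul_self n b
      simp only [minkM, if_true]
      linear_combination M b a e * this
    · intro b' _ hb
      simp [minkM, hb]
    · simp
  set τ : Pt n → Pt n := fun y c =>
    x c + ∑ a, P c a * y a + 1 / 2 * ∑ d, ∑ e, L c d e * (y d * y e) with hτ
  have hτsm : ContDiff ℝ (⊤ : ℕ∞) τ := by
    refine contDiff_pi.2 fun c => ?_
    simp only [hτ]
    fun_prop
  have hτd : ∀ y, HasFDerivAt τ (ContinuousLinearMap.pi fun c =>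
      ∑ a, (P c a + ∑ e, L c a e * y e) •
        ContinuousLinearMap.proj (R := ℝ) (φ := fun _ => ℝ) a) y := fun y =>
    hasFDerivAt_pi.2 fun c => hasFDerivAt_quadratic (x c) (P c) (Lsymm c) y
  have hjac : ∀ y a c, jac n τ y a c = P c a + ∑ e, L c a e * y e := by
    intro y a c
    rw [jac, (hτd y).fderiv]
    simp [Pi.single_apply]
  have hτ0 : τ 0 = x := by
    ext c
    simp [hτ]
  let e : Pt n ≃L[ℝ] Pt n := ContinuousLinearEquiv.equivOfInverse
    (LinearMap.toContinuousLinearMap P.mulVecLin) (LinearMap.toContinuousLinearMap P⁻¹.mulVecLin)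
    (fun v => by simp [Matrix.mulVec_mulVec, Matrix.nonsing_inv_mul _ hP])
    (fun v => by simp [Matrix.mulVec_mulVec, Matrix.mul_nonsing_inv _ hP])
  have he : HasFDerivAt τ (e : Pt n →L[ℝ] Pt n) 0 := by
    refine (hτd 0).congr_fderiv ?_
    ext v c
    simp [e, Matrix.mulVec, dotProduct]
  obtain ⟨σf, U, U', hdiff, h0, hU⟩ := exists_local_diffeo hτsm he hW (by rwa [hτ0])
  refine ⟨τ, σf, U, U', hdiff, h0, hU, hτ0, fun a b => ?_, fun a b => ?_⟩
  · rw [← hPg]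
    simp only [pullTensor, hjac, hτ0, Pi.zero_apply, mul_zero, Finset.sum_const_zero, add_zero]
    exact Finset.sum_congr rfl fun c _ => Finset.sum_congr rfl fun d _ => by ring
  · have hd : DifferentiableAt ℝ (fun y => pullTensor n τ g y a b) 0 :=
      ((((hdiff.isMetricOn (hg.mono hU)).1 a b).contDiffAt
        (hdiff.open_src.mem_nhds h0)).differentiableAt (by simp))
    refine ContinuousLinearMap.coe_injective (LinearMap.pi_ext' fun i => LinearMap.ext_ring ?_)
    simp only [LinearMap.comp_apply, LinearMap.single_apply, ContinuousLinearMap.coe_coe,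
      zero_apply]
    have hline : HasDerivAt (fun t : ℝ => t • (Pi.single i 1 : Pt n)) (Pi.single i 1) 0 := by
      simpa using (hasDerivAt_id (0 : ℝ)).smul_const (Pi.single i 1 : Pt n)
    have hcomp : ∀ F : Pt n → ℝ, DifferentiableAt ℝ F 0 →
        HasDerivAt (fun t : ℝ => F (t • (Pi.single i 1 : Pt n)))
          (fderiv ℝ F 0 (Pi.single i 1)) 0 := by
      intro F hF
      have hF' : HasFDerivAt F (fderiv ℝ F 0) ((0 : ℝ) • (Pi.single i 1 : Pt n)) := by
        rw [zero_smul]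
        exact hF.hasFDerivAt
      exact hF'.comp_hasDerivAt (0 : ℝ) hline
    have h1 := hcomp _ hd
    have hj : ∀ a c, HasDerivAt (fun t : ℝ => jac n τ (t • (Pi.single i 1 : Pt n)) a c)
        (L c a i) 0 := by
      intro a c
      have : (fun t : ℝ => jac n τ (t • (Pi.single i 1 : Pt n)) a c) =
          fun t => P c a + L c a i * t := by
        ext t
        simp [hjac, Pi.single_apply]
      rw [this]
      simpa using ((hasDerivAt_id (0 : ℝ)).const_mul (L c a i)).const_add (P c a)
    have hτl : HasDerivAt (fun t : ℝ => τ (t • (Pi.single i 1 : Pt n))) (fun f => P f i) 0 := by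
      have he' : HasFDerivAt τ (e : Pt n →L[ℝ] Pt n) ((0 : ℝ) • (Pi.single i 1 : Pt n)) := by
        rwa [zero_smul]
      refine (he'.comp_hasDerivAt (0 : ℝ) hline).congr_deriv ?_
      ext f
      simp [e]
    have hgl : ∀ c d, HasDerivAt (fun t : ℝ => g (τ (t • (Pi.single i 1 : Pt n))) c d)
        (D c d i) 0 := by
      intro c d
      have hgd : HasFDerivAt (fun y => g y c d) (fderiv ℝ (fun y => g y c d) x)
          (τ ((0 : ℝ) • (Pi.single i 1 : Pt n))) := by
        rw [zero_smul, hτ0]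
        exact (((hg.1 c d).contDiffAt (hW.mem_nhds hx)).differentiableAt (by simp)).hasFDerivAt
      exact hgd.comp_hasDerivAt (0 : ℝ) hτl
    have h2 := HasDerivAt.fun_sum (u := Finset.univ) fun c _ =>
      HasDerivAt.fun_sum (u := Finset.univ) fun d _ => ((hj a c).fun_mul (hj b d)).fun_mul (hgl c d)
    rw [h1.unique h2]
    simp only [zero_smul, hτ0, hjac, Pi.zero_apply, mul_zero, Finset.sum_const_zero, add_zero,
      add_mul, Finset.sum_add_distrib]
    have h3 : ∑ c, ∑ d, P c a * L d b i * g x c d = M a b i := by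
      rw [← hLP, Finset.sum_comm]
      refine Finset.sum_congr rfl fun c _ => Finset.sum_congr rfl fun d _ => ?_
      rw [hsymm d c]; ring
    have h4 : ∑ c, ∑ d, P c a * P d b * D c d i = G a b i := rfl
    rw [hLP, h3, h4]
    simp only [hM]
    linear_combination (-(1 / 2)) * Gsymm b a i

theorem minkM_mul_self (n : ℕ) : Matrix.of (minkM n) * Matrix.of (minkM n) = 1 := by
  ext a b
  rw [Matrix.mul_apply]
  simp only [Matrix.of_apply, sum_minkM_mul]
  by_cases h : a = b
  · simp [minkM, h, eps_mul_self, Matrix.one_apply]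
  · simp [minkM, h]

namespace NaturalTensor

variable {n k : ℕ}

/-- The value of a natural tensor on the Minkowski metric and a form with constant
components. -/
noncomputable def val (T : NaturalTensor n k) (w : (Fin k → Fin (n + 1)) → ℝ)
    (a b : Fin (n + 1)) : ℝ :=
  T.T Set.univ (fun _ => minkM n) (fun _ => w) 0 a b

theorem eq_mul_energyTensor {T : NaturalTensor n (k + 1)} (hS : IsScaleInvariant T)
    (hV : VanishesAtZeros T) {μ : ℝ}
    (h : ∀ w, IsAlt w → ∀ a b, T.val w a b = μ * en n (k + 1) (Matrix.of (minkM n)) w a b)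
    {W : Set (Pt n)} {g ω} (hW : IsOpen W) (hg : IsMetricOn n W g) (hω : IsFormOn n (k + 1) W ω)
    {x : Pt n} (hx : x ∈ W) (a b : Fin (n + 1)) :
    T.T W g ω x a b = μ * energyTensor n (k + 1) g ω x a b := by
  obtain ⟨τ, σf, U, U', hd, h0, hU, rfl, hp, hdp⟩ := exists_normal_coordinates hW hg hx
  have hJ := hd.isUnit_jac h0
  have hω' := hd.isFormOn (hω.mono hU)
  have hp' : Matrix.of (minkM n) = Matrix.of (jac n τ 0) * Matrix.of (g (τ 0)) *
      (Matrix.of (jac n τ 0))ᵀ := by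
    ext a b
    rw [← pullTensor_eq, hp, Matrix.of_apply]
  have key : Matrix.of (fun c d => T.T W g ω (τ 0) c d -
      μ * energyTensor n (k + 1) g ω (τ 0) c d) = 0 := by
    refine eq_zero_of_conj hJ fun a b => ?_
    simp only [Matrix.of_apply, mul_sub, Finset.sum_sub_distrib]
    rw [← T.pull hd hW hU hg hω h0 a b,
      eq_const_of_flat hS hV (by omega) hd.open_src h0 (hd.isMetricOn (hg.mono hU)) hω' hp hdp]
    have h1 := h _ (hω'.2 0 h0) a b
    have h2 := en_pull n k _ (Matrix.of (g (τ 0))) hJ (ω (τ 0)) a b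
    rw [← hp'] at h2
    rw [sub_eq_zero]
    refine h1.trans ?_
    refine (congrArg (μ * ·) h2).trans ?_
    simp only [Finset.mul_sum]
    refine Finset.sum_congr rfl fun c _ => Finset.sum_congr rfl fun d _ => ?_
    exact mul_left_comm _ _ _
  exact sub_eq_zero.1 (congrFun (congrFun key a) b)

theorem _root_.Paper.IsLorentz.isUnit_det {P : Matrix (Fin (n + 1)) (Fin (n + 1)) ℝ}
    (hP : IsLorentz n P) : IsUnit P.det := by
  refine Matrix.isUnit_det_of_right_inverse (B := Matrix.of (minkM n) * Pᵀ *
    Matrix.of (minkM n)) ?_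
  rw [← minkM_mul_self]
  nth_rewrite 3 [← hP]
  simp only [Matrix.mul_assoc]

/-- Equivariance under Poincaré transformations. -/
theorem pull_affine (T : NaturalTensor n k) {P : Matrix (Fin (n + 1)) (Fin (n + 1)) ℝ}
    (hP : IsLorentz n P) (x : Pt n) {ω} (hω : IsFormOn n k Set.univ ω) (a b : Fin (n + 1)) :
    T.T Set.univ (fun _ => minkM n) (fun y => pullF P (ω (x + Pᵀ *ᵥ y))) 0 a b =
      ∑ c, ∑ d, P a c * P b d * T.T Set.univ (fun _ => minkM n) ω x c d := by
  have hu := hP.isUnit_det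
  have hu' : IsUnit (Pᵀ).det := by rwa [Matrix.det_transpose]
  have hd : IsDiffeoOn n (fun y => x + Pᵀ *ᵥ y) (fun y => (Pᵀ)⁻¹ *ᵥ (y - x))
      Set.univ Set.univ := by
    have hlin : ∀ A : Matrix (Fin (n + 1)) (Fin (n + 1)) ℝ,
        ContDiff ℝ (⊤ : ℕ∞) fun y : Pt n => A *ᵥ y := fun A =>
      (LinearMap.toContinuousLinearMap A.mulVecLin).contDiff
    refine ⟨isOpen_univ, isOpen_univ, Set.mapsTo_univ _ _, Set.mapsTo_univ _ _, fun y _ => ?_,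
      fun y _ => ?_, (contDiff_const.add (hlin _)).contDiffOn,
      ((hlin _).comp (contDiff_id.sub contDiff_const)).contDiffOn⟩
    · simp [Matrix.mulVec_mulVec, Matrix.nonsing_inv_mul _ hu']
    · simp [Matrix.mulVec_mulVec, Matrix.mul_nonsing_inv _ hu']
  have hjac : ∀ y, jac n (fun y => x + Pᵀ *ᵥ y) y = P := by
    intro y
    ext a c
    have : HasFDerivAt (fun y : Pt n => x + Pᵀ *ᵥ y)
        (LinearMap.toContinuousLinearMap (Pᵀ).mulVecLin) y :=
      (LinearMap.toContinuousLinearMap (Pᵀ).mulVecLin).hasFDerivAt.const_add x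
    rw [jac, this.fderiv]
    simp
  have h1 : pullTensor n (fun y => x + Pᵀ *ᵥ y) (fun _ => minkM n) = fun _ => minkM n := by
    ext y a b
    rw [pullTensor_eq, hjac]
    exact congrFun (congrFun hP a) b
  have h2 : pullForm n k (fun y => x + Pᵀ *ᵥ y) ω =
      fun y => pullF P (ω (x + Pᵀ *ᵥ y)) := by
    ext y v
    simp only [pullForm, hjac, pullF]
  have h3 := T.pull hd isOpen_univ subset_rfl (isMetricOn_minkM n _) hω (Set.mem_univ 0) a b
  rw [h1, h2] at h3
  simpa [hjac] using h3

theorem apply_minkM {T : NaturalTensor n k} (hS : IsScaleInvariant T)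
    (hV : VanishesAtZeros T) (hk : 1 ≤ k) {ω} (hω : IsFormOn n k Set.univ ω) (x : Pt n)
    (a b : Fin (n + 1)) : T.T Set.univ (fun _ => minkM n) ω x a b = T.val (ω x) a b := by
  have h1 : IsLorentz n (1 : Matrix (Fin (n + 1)) (Fin (n + 1)) ℝ) := by simp [IsLorentz]
  have hpull : ∀ w : (Fin k → Fin (n + 1)) → ℝ,
      pullF (1 : Matrix (Fin (n + 1)) (Fin (n + 1)) ℝ) w = w := by
    intro w
    ext v
    rw [pullF, Finset.sum_eq_single v]
    · simp
    · intro u _ hu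
      obtain ⟨j, hj⟩ := Function.ne_iff.1 hu
      rw [Finset.prod_eq_zero (Finset.mem_univ j) (by simp [hj.symm]), zero_mul]
    · simp
  have h2 := T.pull_affine h1 x hω a b
  have h3 : ∑ c, ∑ d, (1 : Matrix (Fin (n + 1)) (Fin (n + 1)) ℝ) a c *
      (1 : Matrix (Fin (n + 1)) (Fin (n + 1)) ℝ) b d *
        T.T Set.univ (fun _ => minkM n) ω x c d = T.T Set.univ (fun _ => minkM n) ω x a b := by
    simp [Matrix.one_apply]
  rw [h3] at h2
  rw [← h2]
  simp only [hpull, Matrix.transpose_one, Matrix.one_mulVec]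
  have hω' : IsFormOn n k Set.univ fun y => ω (x + y) :=
    ⟨fun v => (hω.1 v).comp (contDiff_const.add contDiff_id).contDiffOn (Set.mapsTo_univ _ _),
      fun y _ => hω.2 _ (Set.mem_univ _)⟩
  rw [eq_const_of_flat hS hV hk isOpen_univ (Set.mem_univ 0) (isMetricOn_minkM n _) hω'
    (fun _ _ => rfl) (fun _ _ => by simp), add_zero, val]

theorem val_pullF (T : NaturalTensor n k) {P : Matrix (Fin (n + 1)) (Fin (n + 1)) ℝ}
    (hP : IsLorentz n P) {w} (hw : IsAlt w) (a b : Fin (n + 1)) :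
    T.val (pullF P w) a b = ∑ c, ∑ d, P a c * P b d * T.val w c d :=
  T.pull_affine hP 0 (isFormOn_const _ hw) a b

theorem val_smul {T : NaturalTensor n k} (hS : IsScaleInvariant T) (hk : 1 ≤ k) {w}
    (hw : IsAlt w) {t : ℝ} (ht : 0 < t) (a b : Fin (n + 1)) :
    T.val (t • w) a b = t ^ 2 * T.val w a b := by
  have hball : ∀ r > 0, ∀ w', IsAlt w' →
      T.T (Metric.ball 0 r) (fun _ => minkM n) (fun _ => w') 0 a b = T.val w' a b := by
    intro r hr w' hw'
    rw [val, T.localize _ Set.univ _ _ _ _ Metric.isOpen_ball isOpen_univ (Set.subset_univ _)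
      (isMetricOn_minkM n _) (isFormOn_const _ hw') (isMetricOn_minkM n _)
      (isFormOn_const _ hw') (fun _ _ => ⟨rfl, rfl⟩) 0 (Metric.mem_ball_self hr)]
  rw [← hball 1 one_pos _ (hw.smul t), ← hball (t * 1) (by linarith) _ hw]
  exact dilation hS hk ht one_pos (isMetricOn_minkM n _) (isFormOn_const _ hw)
    (isMetricOn_minkM n _) (isFormOn_const _ (hw.smul t)) a b

theorem contDiff_val (T : NaturalTensor n k) {m : ℕ} {u : Fin m → (Fin k → Fin (n + 1)) → ℝ}
    (hu : ∀ i, IsAlt (u i)) (a b : Fin (n + 1)) :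
    ContDiff ℝ (⊤ : ℕ∞) fun s : Fin m → ℝ => T.val (∑ i, s i • u i) a b := by
  have halt : ∀ s : Fin m → ℝ, IsAlt (∑ i, s i • u i) := by
    intro s v σ
    simp only [Finset.sum_apply, Pi.smul_apply, smul_eq_mul, Finset.mul_sum]
    exact Finset.sum_congr rfl fun i _ => by rw [hu i v σ]; ring
  have := T.regular m Set.univ Set.univ isOpen_univ isOpen_univ (fun _ _ => minkM n)
    (fun s _ => ∑ i, s i • u i) (fun _ _ => contDiffOn_const)
    (fun v => by
      simp only [Finset.sum_apply, Pi.smul_apply, smul_eq_mul]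
      exact ContDiff.contDiffOn (by fun_prop))
    (fun s _ => ⟨isMetricOn_minkM n _, isFormOn_const _ (halt s)⟩) a b
  rw [Set.univ_prod_univ, contDiffOn_univ] at this
  exact this.comp (by fun_prop : ContDiff ℝ (⊤ : ℕ∞) fun s : Fin m → ℝ => (s, (0 : Pt n)))

end NaturalTensor

theorem IsAlt.sum {ι : Type*} {k : ℕ} {α : Type*} (s : Finset α) (c : α → ℝ)
    {u : α → (Fin k → ι) → ℝ} (hu : ∀ i, IsAlt (u i)) : IsAlt (∑ i ∈ s, c i • u i) := by
  intro v σ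
  simp only [Finset.sum_apply, Pi.smul_apply, smul_eq_mul, Finset.mul_sum]
  exact Finset.sum_congr rfl fun i _ => by rw [hu i v σ]; ring

/-- A smooth, homogeneous of degree two and Lorentz equivariant map is given by an equivariant
bilinear form. -/
theorem exists_isEquivariantForm {n k : ℕ}
    {F : ((Fin k → Fin (n + 1)) → ℝ) → Fin (n + 1) → Fin (n + 1) → ℝ}
    (hsm : ∀ (m : ℕ) (u : Fin m → (Fin k → Fin (n + 1)) → ℝ), (∀ i, IsAlt (u i)) → ∀ a b,
      ContDiff ℝ (⊤ : ℕ∞) fun s : Fin m → ℝ => F (∑ i, s i • u i) a b)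
    (hom : ∀ w, IsAlt w → ∀ t : ℝ, 0 < t → ∀ a b, F (t • w) a b = t ^ 2 * F w a b)
    (heq : ∀ P, IsLorentz n P → ∀ w, IsAlt w → ∀ a b,
      F (pullF P w) a b = ∑ c, ∑ d, P a c * P b d * F w c d) :
    ∃ β, IsEquivariantForm n k β ∧ ∀ w, IsAlt w → ∀ a b, β a b w w = F w a b := by
  set ε := Fintype.equivFin (Fin k → Fin (n + 1)) with hε
  set u : Fin (Fintype.card (Fin k → Fin (n + 1))) → (Fin k → Fin (n + 1)) → ℝ :=
    fun i => eb (ε.symm i) with hu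
  have hua : ∀ i, IsAlt (u i) := fun i => eb_isAlt _
  choose B Bsymm hB using fun a b => exists_bilin_of_homogeneous isOpen_univ (Set.mem_univ _)
    (hsm _ u hua a b).contDiffOn fun s _ t ht _ => ⟨Set.mem_univ _, by
      rw [← hom _ (IsAlt.sum Finset.univ s hua) t ht a b, Finset.smul_sum]
      simp only [Pi.smul_apply, smul_eq_mul, smul_smul]⟩
  set R : ((Fin k → Fin (n + 1)) → ℝ) →ₗ[ℝ]
      (Fin (Fintype.card (Fin k → Fin (n + 1))) → ℝ) := LinearMap.funLeft ℝ ℝ ε.symm with hR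
  have hk : (0 : ℝ) < k.factorial := by exact_mod_cast k.factorial_pos
  have hval : ∀ w, IsAlt w → ∀ a b, B a b (R w) (R w) = (k.factorial : ℝ) ^ 2 * F w a b := by
    intro w hw a b
    rw [← hB a b _ (Set.mem_univ _), ← hom _ hw _ hk, ← sum_smul_eb hw,
      ← ε.symm.sum_comp fun v => w v • eb v]
    rfl
  set β : Fin (n + 1) → Fin (n + 1) →
      (((Fin k → Fin (n + 1)) → ℝ) →ₗ[ℝ] ((Fin k → Fin (n + 1)) → ℝ) →ₗ[ℝ] ℝ) :=
    fun a b => (((k.factorial : ℝ) ^ 2)⁻¹ • B a b).compl₁₂ R R with hβ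
  have hβF : ∀ w, IsAlt w → ∀ a b, β a b w w = F w a b := by
    intro w hw a b
    have : β a b w w = ((k.factorial : ℝ) ^ 2)⁻¹ * B a b (R w) (R w) := rfl
    rw [this, hval w hw, inv_mul_cancel_left₀ (by positivity)]
  refine ⟨β, ⟨fun a b w w' => ?_, fun P hP w hw a b => ?_⟩, hβF⟩
  · exact congrArg (((k.factorial : ℝ) ^ 2)⁻¹ * ·) (Bsymm a b (R w) (R w'))
  · rw [hβF _ (hw.pullF P), heq P hP w hw]
    simp only [hβF w hw, Finset.mul_sum, mul_assoc]

theorem contr_smul {ι : Type*} [Fintype ι] {k : ℕ} (G : Matrix ι ι ℝ) (t : ℝ)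
    (φ ψ : (Fin k → ι) → ℝ) : contr G (t • φ) (t • ψ) = t ^ 2 * contr G φ ψ := by
  simp only [contr, Finset.mul_sum, Pi.smul_apply, smul_eq_mul]
  exact Finset.sum_congr rfl fun v _ => Finset.sum_congr rfl fun w _ => by ring

theorem en_smul (n k : ℕ) (G : Matrix (Fin (n + 1)) (Fin (n + 1)) ℝ) (t : ℝ)
    (w : (Fin (k + 1) → Fin (n + 1)) → ℝ) (a b : Fin (n + 1)) :
    en n (k + 1) G (t • w) a b = t ^ 2 * en n (k + 1) G w a b := by
  have h : ∀ c, (fun v => (t • w) (Fin.cons c v)) = t • fun v => w (Fin.cons c v) :=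
    fun c => rfl
  rw [en_eq, en_eq, h, h, contr_smul, contr_smul]
  ring

theorem contDiff_en (n k : ℕ) (G : Matrix (Fin (n + 1)) (Fin (n + 1)) ℝ) {m : ℕ}
    (u : Fin m → (Fin (k + 1) → Fin (n + 1)) → ℝ) (a b : Fin (n + 1)) :
    ContDiff ℝ (⊤ : ℕ∞) fun s : Fin m → ℝ => en n (k + 1) G (∑ i, s i • u i) a b := by
  simp only [en_eq, contr, Finset.sum_apply, Pi.smul_apply, smul_eq_mul]
  fun_prop

theorem minkM_inv (n : ℕ) : (Matrix.of (minkM n))⁻¹ = Matrix.of (minkM n) :=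
  Matrix.inv_eq_right_inv (minkM_mul_self n)

theorem contr_minkM {n k : ℕ} (φ ψ : (Fin k → Fin (n + 1)) → ℝ) :
    contr (Matrix.of (minkM n))⁻¹ φ ψ = ∑ v, (∏ j, eps n (v j)) * φ v * ψ v := by
  rw [minkM_inv, contr]
  refine Finset.sum_congr rfl fun v _ => ?_
  rw [Finset.sum_eq_single v]
  · simp [minkM]
  · intro u _ hu
    obtain ⟨j, hj⟩ := Function.ne_iff.1 hu
    rw [Finset.prod_eq_zero (Finset.mem_univ j) (by simp [minkM, hj.symm]), zero_mul, zero_mul]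
  · simp

theorem eb_self {ι : Type*} [DecidableEq ι] {k : ℕ} {u : Fin k → ι} (hu : Function.Injective u) :
    eb u u = 1 := by
  rw [eb_apply]
  have : (Matrix.of fun i j => if u i = u j then (1 : ℝ) else 0) = 1 := by
    ext i j
    simp [Matrix.one_apply, hu.eq_iff]
  rw [this, Matrix.det_one]

theorem eb_apply_eq_zero {ι : Type*} [DecidableEq ι] {k : ℕ} {u v : Fin k → ι} {j : Fin k}
    (h : v j ∉ Set.range u) : eb u v = 0 := by
  rw [eb_apply]
  refine Matrix.det_eq_zero_of_column_eq_zero j fun i => ?_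
  simp only [Matrix.of_apply, ite_eq_right_iff, one_ne_zero, imp_false]
  exact fun hi => h ⟨i, hi⟩

theorem sum_mul_eb {ι : Type*} [Fintype ι] [DecidableEq ι] {k : ℕ} (f : (Fin k → ι) → ℝ)
    (u : Fin k → ι) :
    ∑ v, f v * eb u v = ∑ σ : Equiv.Perm (Fin k), ((Equiv.Perm.sign σ : ℤ) : ℝ) * f (u ∘ σ) := by
  simp only [eb_apply, Matrix.det_apply', Finset.mul_sum]
  rw [Finset.sum_comm]
  refine Finset.sum_congr rfl fun σ _ => ?_
  rw [Finset.sum_eq_single (u ∘ σ)]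
  · simp [mul_comm]
  · intro v _ hv
    obtain ⟨j, hj⟩ := Function.ne_iff.1 hv
    have : ∏ i, (Matrix.of fun i j => if u i = v j then (1 : ℝ) else 0) (σ i) i = 0 :=
      Finset.prod_eq_zero (Finset.mem_univ j) (by
        simp only [Matrix.of_apply, ite_eq_right_iff, one_ne_zero, imp_false]
        exact fun h => hj h.symm)
    rw [this, mul_zero, mul_zero]
  · simp

theorem contr_eb_self {n k : ℕ} {u : Fin k → Fin (n + 1)} (hu : Function.Injective u) :
    contr (Matrix.of (minkM n))⁻¹ (eb u) (eb u) = (k.factorial : ℝ) * ∏ j, eps n (u j) := by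
  rw [contr_minkM, sum_mul_eb]
  have : ∀ σ : Equiv.Perm (Fin k), ((Equiv.Perm.sign σ : ℤ) : ℝ) *
      ((∏ j, eps n ((u ∘ σ) j)) * eb u (u ∘ σ)) = ∏ j, eps n (u j) := by
    intro σ
    rw [eb_isAlt u u σ, eb_self hu, mul_one]
    have h1 : ∏ j, eps n ((u ∘ σ) j) = ∏ j, eps n (u j) :=
      Equiv.prod_comp σ fun j => eps n (u j)
    have h2 : ((Equiv.Perm.sign σ : ℤ) : ℝ) * ((Equiv.Perm.sign σ : ℤ) : ℝ) = 1 := by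
      rw [← Int.cast_mul, Int.units_coe_mul_self, Int.cast_one]
    rw [h1, mul_left_comm, h2, mul_one]
  rw [Finset.sum_congr rfl fun σ _ => this σ]
  simp [Fintype.card_perm]

theorem eb_cons_cons {ι : Type*} [DecidableEq ι] {k : ℕ} {a : ι} {u : Fin k → ι}
    (ha : a ∉ Set.range u) (v : Fin k → ι) :
    eb (Fin.cons a u : Fin (k + 1) → ι) (Fin.cons a v) = eb u v := by
  rw [eb_apply, Matrix.det_succ_column_zero, Finset.sum_eq_single 0]
  · simp only [Fin.val_zero, pow_zero, Matrix.of_apply, Fin.cons_zero, if_true, one_mul,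
      eb_apply]
    rfl
  · intro i _ hi
    obtain ⟨j, rfl⟩ := Fin.exists_succ_eq.2 hi
    have : u j ≠ a := fun h => ha ⟨j, h⟩
    simp [this]
  · simp

theorem en_eb_of_mem {n k : ℕ} {u : Fin k → Fin (n + 1)} (hu : Function.Injective u)
    (h0 : (0 : Fin (n + 1)) ∉ Set.range u) :
    en n (k + 1) (Matrix.of (minkM n)) (eb (Fin.cons 0 u)) 0 0 =
      (-1) ^ k * (1 / 2) * ∏ j, eps n (u j) := by
  have h1 : (fun v => eb (Fin.cons 0 u : Fin (k + 1) → Fin (n + 1)) (Fin.cons 0 v)) = eb u :=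
    funext fun v => eb_cons_cons h0 v
  have h2 : Function.Injective (Fin.cons 0 u : Fin (k + 1) → Fin (n + 1)) :=
    Fin.cons_injective_iff.2 ⟨h0, hu⟩
  rw [en_eq, h1, contr_eb_self hu, contr_eb_self h2, Fin.prod_univ_succ]
  have : (k.factorial : ℝ) ≠ 0 := by exact_mod_cast k.factorial_ne_zero
  have h' : ((k + 1).factorial : ℝ) ≠ 0 := by exact_mod_cast (k + 1).factorial_ne_zero
  simp only [Fin.cons_zero, Fin.cons_succ, Matrix.of_apply, minkM, if_true]
  simp only [eps, if_true]
  field_simp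
  ring

theorem en_eb_of_notMem {n k : ℕ} {u : Fin k → Fin (n + 1)} (hu : Function.Injective u)
    (h0 : (0 : Fin (n + 1)) ∉ Set.range u) {j : Fin (n + 1)} (hj : j ∉ Set.range u)
    (hj0 : j ≠ 0) :
    en n (k + 1) (Matrix.of (minkM n)) (eb (Fin.cons j u)) 0 0 =
      (-1) ^ k * (1 / 2) * ∏ j, eps n (u j) := by
  have h1 : (fun v => eb (Fin.cons j u : Fin (k + 1) → Fin (n + 1)) (Fin.cons 0 v)) = 0 := by
    funext v
    refine eb_apply_eq_zero (j := 0) ?_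
    rw [Fin.cons_zero, Fin.range_cons]
    rintro (h | h)
    · exact hj0 h.symm
    · exact h0 h
  have h2 : Function.Injective (Fin.cons j u : Fin (k + 1) → Fin (n + 1)) :=
    Fin.cons_injective_iff.2 ⟨hj, hu⟩
  have h3 : contr (Matrix.of (minkM n))⁻¹ (0 : (Fin k → Fin (n + 1)) → ℝ) 0 = 0 := by
    simp [contr]
  rw [en_eq, h1, contr_eb_self h2, h3, Fin.prod_univ_succ]
  have : (k.factorial : ℝ) ≠ 0 := by exact_mod_cast k.factorial_ne_zero
  have h' : ((k + 1).factorial : ℝ) ≠ 0 := by exact_mod_cast (k + 1).factorial_ne_zero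
  simp only [Fin.cons_zero, Fin.cons_succ, Matrix.of_apply, minkM, if_true]
  simp only [eps, if_true, hj0, if_false]
  field_simp
  ring

theorem eb_cons {ι : Type*} [DecidableEq ι] {k : ℕ} (a : ι) (u : Fin k → ι)
    (v : Fin (k + 1) → ι) :
    eb (Fin.cons a u : Fin (k + 1) → ι) v =
      ∑ l : Fin (k + 1), (-1) ^ (l : ℕ) * ((if v l = a then 1 else 0) * eb u (v ∘ l.succAbove)) := by
  rw [eb_apply, Matrix.det_succ_row_zero]
  refine Finset.sum_congr rfl fun l _ => ?_
  rw [eb_apply, mul_assoc]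
  simp only [Matrix.of_apply, Fin.cons_zero, eq_comm (a := a)]
  rfl

theorem eb_cons_swap {ι : Type*} [DecidableEq ι] {k : ℕ} (a b : ι) (r : Fin k → ι) :
    eb (Fin.cons a (Fin.cons b r : Fin (k + 1) → ι) : Fin (k + 2) → ι) =
      -eb (Fin.cons b (Fin.cons a r : Fin (k + 1) → ι) : Fin (k + 2) → ι) := by
  have h : (Fin.cons a (Fin.cons b r : Fin (k + 1) → ι) : Fin (k + 2) → ι) =
      (Fin.cons b (Fin.cons a r : Fin (k + 1) → ι) : Fin (k + 2) → ι) ∘ Equiv.swap 0 1 := by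
    funext i
    refine Fin.cases ?_ (fun i => Fin.cases ?_ (fun i => ?_) i) i
    · rw [Function.comp_apply, Equiv.swap_apply_left]
      rfl
    · have : Equiv.swap (0 : Fin (k + 2)) 1 (Fin.succ 0) = 0 := Equiv.swap_apply_right 0 1
      rw [Function.comp_apply, this]
      rfl
    · rw [Function.comp_apply, Equiv.swap_apply_of_ne_of_ne]
      · simp
      · exact Fin.succ_ne_zero _
      · rw [← Fin.succ_zero_eq_one]
        exact fun h => Fin.succ_ne_zero _ (Fin.succ_injective _ h)
  rw [h, eb_comp_perm, Equiv.Perm.sign_swap (by simp)]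
  simp

theorem pd_linear {n : ℕ} (a i j : Fin (n + 1)) (A B : ℝ) (x : Pt n) :
    pd n a (fun y => y i * A + y j * B) x =
      (if a = i then 1 else 0) * A + (if a = j then 1 else 0) * B := by
  have hi := hasFDerivAt_apply (𝕜 := ℝ) (F' := fun _ : Fin (n + 1) => ℝ) i x
  have hj := hasFDerivAt_apply (𝕜 := ℝ) (F' := fun _ : Fin (n + 1) => ℝ) j x
  have h : HasFDerivAt (fun y : Pt n => y i * A + y j * B) _ x :=
    (hi.mul_const A).add (hj.mul_const B)
  rw [pd, h.fderiv]
  simp [Pi.single_apply, eq_comm, mul_comm]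

theorem pd_const {n : ℕ} (a : Fin (n + 1)) (c : ℝ) (x : Pt n) : pd n a (fun _ => c) x = 0 := by
  simp [pd]

theorem christoffel_minkM (n : ℕ) (x : Pt n) (c a b : Fin (n + 1)) :
    christoffel n (fun _ => minkM n) x c a b = 0 := by
  simp [christoffel, pd_const]

theorem sum_ginv_minkM (n : ℕ) (x : Pt n) (a : Fin (n + 1)) (f : Fin (n + 1) → ℝ) :
    ∑ b, ginv n (fun _ => minkM n) x a b * f b = eps n a * f a := by
  have : ginv n (fun _ => minkM n) x = Matrix.of (minkM n) := minkM_inv n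
  simp only [this, Matrix.of_apply, sum_minkM_mul]

/-- A closed and co-closed form with linear components. -/
noncomputable def linForm (n : ℕ) {k : ℕ} (i j : Fin (n + 1)) (r : Fin k → Fin (n + 1)) :
    Pt n → (Fin (k + 1) → Fin (n + 1)) → ℝ :=
  fun x v => x j * eb (Fin.cons i r : Fin (k + 1) → Fin (n + 1)) v +
    x i * eb (Fin.cons j r : Fin (k + 1) → Fin (n + 1)) v

theorem linForm_eq {n k : ℕ} (i j : Fin (n + 1)) (r : Fin k → Fin (n + 1)) (x : Pt n) :
    linForm n i j r x = x j • eb (Fin.cons i r : Fin (k + 1) → Fin (n + 1)) +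
      x i • eb (Fin.cons j r : Fin (k + 1) → Fin (n + 1)) := rfl

theorem isFormOn_linForm {n k : ℕ} (i j : Fin (n + 1)) (r : Fin k → Fin (n + 1)) :
    IsFormOn n (k + 1) Set.univ (linForm n i j r) := by
  refine ⟨fun v => ContDiff.contDiffOn ?_, fun x _ => ?_⟩
  · unfold linForm
    fun_prop
  · exact ((eb_isAlt _).smul _).add ((eb_isAlt _).smul _)

theorem dext_linForm {n k : ℕ} (i j : Fin (n + 1)) (r : Fin k → Fin (n + 1)) (x : Pt n)
    (v : Fin (k + 1 + 1) → Fin (n + 1)) : dext n (k + 1) (linForm n i j r) x v = 0 := by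
  simp only [dext, linForm, pd_linear, mul_add, Finset.sum_add_distrib]
  rw [← eb_cons, ← eb_cons, eb_cons_swap]
  simp

theorem codiff_linForm {n k : ℕ} {i j : Fin (n + 1)} {r : Fin k → Fin (n + 1)} (hij : i ≠ j)
    (hi : i ∉ Set.range r) (hj : j ∉ Set.range r) (x : Pt n) (v : Fin k → Fin (n + 1)) :
    codiff n (k + 1) (fun _ => minkM n) (linForm n i j r) x v = 0 := by
  have h1 : eb (Fin.cons i r : Fin (k + 1) → Fin (n + 1)) (Fin.cons j v) = 0 := by
    refine eb_apply_eq_zero (j := 0) ?_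
    rw [Fin.cons_zero, Fin.range_cons]
    rintro (h | h)
    exacts [hij h.symm, hj h]
  have h2 : eb (Fin.cons j r : Fin (k + 1) → Fin (n + 1)) (Fin.cons i v) = 0 := by
    refine eb_apply_eq_zero (j := 0) ?_
    rw [Fin.cons_zero, Fin.range_cons]
    rintro (h | h)
    exacts [hij h, hi h]
  have h3 : ∀ a b, covd n (k + 1) (fun _ => minkM n) (linForm n i j r) x a
      (dcons (k + 1) b v) = (if a = j then 1 else 0) *
        eb (Fin.cons i r : Fin (k + 1) → Fin (n + 1)) (Fin.cons b v) +
      (if a = i then 1 else 0) *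
        eb (Fin.cons j r : Fin (k + 1) → Fin (n + 1)) (Fin.cons b v) := by
    intro a b
    have : dcons (k + 1) b v = Fin.cons b v := dcons_succ k b v
    simp only [covd, christoffel_minkM, zero_mul, Finset.sum_const_zero, sub_zero, linForm, this,
      pd_linear]
  unfold codiff
  rw [neg_eq_zero]
  refine Finset.sum_eq_zero fun a _ => ?_
  refine (sum_ginv_minkM n x a fun b => covd n (k + 1) (fun _ => minkM n) (linForm n i j r) x a
      (dcons (k + 1) b v)).trans ?_
  rw [h3]
  by_cases hai : a = i
  · subst hai
    simp [h2, hij]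
  · by_cases haj : a = j
    · subst haj
      simp [h1, hai]
    · simp [hai, haj]

theorem pd_quadratic {n : ℕ} (a i j : Fin (n + 1)) (A B C : ℝ) (x : Pt n) :
    pd n a (fun y => y j * y j * A + 2 * (y j * y i) * B + y i * y i * C) x =
      (if a = j then 1 else 0) * (2 * x j * A + 2 * x i * B) +
      (if a = i then 1 else 0) * (2 * x j * B + 2 * x i * C) := by
  have hi := hasFDerivAt_apply (𝕜 := ℝ) (F' := fun _ : Fin (n + 1) => ℝ) i x
  have hj := hasFDerivAt_apply (𝕜 := ℝ) (F' := fun _ : Fin (n + 1) => ℝ) j x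
  have h : HasFDerivAt (fun y : Pt n => y j * y j * A + 2 * (y j * y i) * B + y i * y i * C) _ x :=
    (((hj.fun_mul hj).mul_const A).add (((hj.fun_mul hi).const_mul 2).mul_const B)).add
      ((hi.fun_mul hi).mul_const C)
  rw [pd, h.fderiv]
  simp [Pi.single_apply, eq_comm]
  split_ifs <;> ring

theorem divT_linForm {n k : ℕ} {β} (h : IsEquivariantForm n (k + 1) β)
    {t : Pt n → Fin (n + 1) → Fin (n + 1) → ℝ} {i j : Fin (n + 1)} (hij : i ≠ j)
    {r : Fin k → Fin (n + 1)}
    (ht : ∀ x a b, t x a b = β a b (linForm n i j r x) (linForm n i j r x)) (b : Fin (n + 1)) :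
    divT n (fun _ => minkM n) t (Pi.single i 1) b =
      2 * (eps n j * β j b (eb (Fin.cons i r : Fin (k + 1) → Fin (n + 1)))
        (eb (Fin.cons j r : Fin (k + 1) → Fin (n + 1))) +
      eps n i * β i b (eb (Fin.cons j r : Fin (k + 1) → Fin (n + 1)))
        (eb (Fin.cons j r : Fin (k + 1) → Fin (n + 1)))) := by
  have h1 : ∀ a c, (fun y => t y a c) = fun y => y j * y j *
      β a c (eb (Fin.cons i r : Fin (k + 1) → Fin (n + 1)))
        (eb (Fin.cons i r : Fin (k + 1) → Fin (n + 1))) +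
      2 * (y j * y i) * β a c (eb (Fin.cons i r : Fin (k + 1) → Fin (n + 1)))
        (eb (Fin.cons j r : Fin (k + 1) → Fin (n + 1))) +
      y i * y i * β a c (eb (Fin.cons j r : Fin (k + 1) → Fin (n + 1)))
        (eb (Fin.cons j r : Fin (k + 1) → Fin (n + 1))) := by
    intro a c
    funext y
    rw [ht, linForm_eq]
    simp only [map_add, map_smul, LinearMap.add_apply, LinearMap.smul_apply, smul_eq_mul]
    rw [h.symm a c (eb (Fin.cons j r : Fin (k + 1) → Fin (n + 1)))
      (eb (Fin.cons i r : Fin (k + 1) → Fin (n + 1)))]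
    ring
  simp only [divT, christoffel_minkM, zero_mul, Finset.sum_const_zero, sub_zero, sum_ginv_minkM,
    h1, pd_quadratic, mul_add, Finset.sum_add_distrib]
  simp [hij.symm]
  ring

theorem IsEquivariantForm.eq_of_divergence {n k : ℕ} {β} (h : IsEquivariantForm n (k + 1) β)
    {r : Fin k → Fin (n + 1)} (hr : Function.Injective r) (h0 : (0 : Fin (n + 1)) ∉ Set.range r)
    {j : Fin (n + 1)} (hj : j ∉ Set.range r) (hj0 : j ≠ 0)
    (hdiv : divT n (fun _ => minkM n)
      (fun x a b => β a b (linForm n 0 j r x) (linForm n 0 j r x)) (Pi.single 0 1) 0 = 0) :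
    β 0 0 (eb (Fin.cons j r : Fin (k + 1) → Fin (n + 1)))
        (eb (Fin.cons j r : Fin (k + 1) → Fin (n + 1))) =
      β 0 0 (eb (Fin.cons 0 r : Fin (k + 1) → Fin (n + 1)))
        (eb (Fin.cons 0 r : Fin (k + 1) → Fin (n + 1))) := by
  have hu : Function.Injective (Fin.cons 0 r : Fin (k + 1) → Fin (n + 1)) :=
    Fin.cons_injective_iff.2 ⟨h0, hr⟩
  have hju : j ∉ Set.range (Fin.cons 0 r : Fin (k + 1) → Fin (n + 1)) := by
    rw [Fin.range_cons]
    rintro (e | e)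
    exacts [hj0 e, hj e]
  obtain ⟨e1, -, -, e2, -⟩ := h.plane_relations hu 0 hju
  rw [Fin.update_cons_zero, Fin.cons_zero] at e1 e2
  rw [divT_linForm h hj0.symm fun _ _ _ => rfl] at hdiv
  have h00 : eps n 0 = 1 := if_pos rfl
  have hjj : eps n j = -1 := if_neg hj0
  rw [h00, hjj] at hdiv e2
  linarith

theorem exists_val_eq {n k : ℕ} (hk : k ≤ n) {T : NaturalTensor n (k + 1)}
    (hS : IsScaleInvariant T)
    (hdiv : ∀ i j (r : Fin k → Fin (n + 1)), i ≠ j → i ∉ Set.range r → j ∉ Set.range r → ∀ x b,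
      divT n (fun _ => minkM n) (fun y => T.val (linForm n i j r y)) x b = 0) :
    ∃ μ : ℝ, ∀ w, IsAlt w → ∀ a b,
      T.val w a b = μ * en n (k + 1) (Matrix.of (minkM n)) w a b := by
  set r : Fin k → Fin (n + 1) := fun i => (Fin.castLE hk i).succ with hr_def
  have hr : Function.Injective r := (Fin.succ_injective n).comp (Fin.castLE_injective hk)
  have h0 : (0 : Fin (n + 1)) ∉ Set.range r := fun ⟨i, hi⟩ => Fin.succ_ne_zero _ hi
  have hu : Function.Injective (Fin.cons 0 r : Fin (k + 1) → Fin (n + 1)) :=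
    Fin.cons_injective_iff.2 ⟨h0, hr⟩
  have hE := en_eb_of_mem hr h0
  have hE0 : en n (k + 1) (Matrix.of (minkM n)) (eb (Fin.cons 0 r)) 0 0 ≠ 0 := by
    rw [hE]
    exact mul_ne_zero (mul_ne_zero (pow_ne_zero _ (by norm_num)) (by norm_num))
      (Finset.prod_ne_zero_iff.2 fun i _ => eps_ne_zero n _)
  set μ := T.val (eb (Fin.cons 0 r)) 0 0 / en n (k + 1) (Matrix.of (minkM n)) (eb (Fin.cons 0 r)) 0 0
    with hμ
  have hμE : T.val (eb (Fin.cons 0 r)) 0 0 =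
      μ * en n (k + 1) (Matrix.of (minkM n)) (eb (Fin.cons 0 r)) 0 0 :=
    (div_mul_cancel₀ _ hE0).symm
  obtain ⟨β, hβ, hβT⟩ := exists_isEquivariantForm (F := T.val)
    (fun m u hu a b => T.contDiff_val hu a b)
    (fun w hw t ht a b => NaturalTensor.val_smul hS (Nat.le_add_left 1 k) hw ht a b)
    (fun P hP w hw a b => T.val_pullF hP hw a b)
  obtain ⟨β', hβ', hβF⟩ := exists_isEquivariantForm
    (F := fun w a b => T.val w a b - μ * en n (k + 1) (Matrix.of (minkM n)) w a b)
    (fun m u hu a b => (T.contDiff_val hu a b).sub (contDiff_const.mul (contDiff_en n k _ u a b)))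
    (fun w hw t ht a b => by
      rw [NaturalTensor.val_smul hS (Nat.le_add_left 1 k) hw ht, en_smul]
      ring)
    (fun P hP w hw a b => by
      have h := en_pull n k P (Matrix.of (minkM n)) hP.isUnit_det w a b
      rw [show P * Matrix.of (minkM n) * Pᵀ = Matrix.of (minkM n) from hP] at h
      rw [T.val_pullF hP hw, h, Finset.mul_sum, ← Finset.sum_sub_distrib]
      refine Finset.sum_congr rfl fun c _ => ?_
      rw [Finset.mul_sum, ← Finset.sum_sub_distrib]
      exact Finset.sum_congr rfl fun d _ => by ring)
  refine ⟨μ, fun w hw a b => sub_eq_zero.1 ((hβF w hw a b).symm.trans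
    (hβ'.eq_zero ⟨Fin.cons 0 r, 0, hu, ?_⟩ (fun hkn => ?_) hw a b))⟩
  · rw [Fin.cons_zero, hβF _ (eb_isAlt _), hμE, sub_self]
  · set j : Fin (n + 1) := ⟨k + 1, by omega⟩ with hj_def
    have hj : j ∉ Set.range r := by
      rintro ⟨i, hi⟩
      have := congrArg Fin.val hi
      simp only [hr_def, hj_def, Fin.val_succ, Fin.val_castLE] at this
      omega
    have hj0 : j ≠ 0 := Fin.ne_of_val_ne (Nat.succ_ne_zero k)
    refine ⟨Fin.cons j r, 0, Fin.cons_injective_iff.2 ⟨hj, hr⟩, ?_, ?_⟩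
    · rw [Fin.range_cons]
      rintro (e | e)
      exacts [hj0 e.symm, h0 e]
    · have e := hβ.eq_of_divergence hr h0 hj hj0 (by
        rw [← hdiv 0 j r hj0.symm h0 hj (Pi.single 0 1) 0]
        congr 1
        funext y a b
        exact hβT _ ((isFormOn_linForm 0 j r).2 y (Set.mem_univ y)) a b)
      rw [hβT _ (eb_isAlt _), hβT _ (eb_isAlt _)] at e
      rw [hβF _ (eb_isAlt _), e, hμE, en_eb_of_notMem hr h0 hj hj0, hE, sub_self]


/-- a natural tensor that is independent of the unit of scale, vanishes
where the form vanishes, and is divergence-free on closed and co-closed forms, is a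
constant multiple of the energy tensor. -/
theorem statement2 (n k : ℕ) (hn : 1 ≤ n) (hk1 : 1 ≤ k) (hk2 : k ≤ n + 1)
    (T : NaturalTensor n k)
    (scale : ∀ W g ω, IsOpen W → IsMetricOn n W g → IsFormOn n k W ω →
      ∀ lam : ℝ, 0 < lam → ∀ x ∈ W, ∀ a b,
        T.T W (fun y c d => lam ^ 2 * g y c d) (fun y v => lam ^ (k - 1) * ω y v) x a b
          = T.T W g ω x a b)
    (vanish : ∀ W g ω, IsOpen W → IsMetricOn n W g → IsFormOn n k W ω →
      ∀ x ∈ W, (∀ v, ω x v = 0) → ∀ a b, T.T W g ω x a b = 0)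
    (divcond : ∀ W g ω, IsOpen W → IsMetricOn n W g → IsFormOn n k W ω →
      (∀ x ∈ W, ∀ u, dext n k ω x u = 0) →
      (∀ x ∈ W, ∀ v, codiff n k g ω x v = 0) →
      ∀ x ∈ W, ∀ b, divT n g (T.T W g ω) x b = 0) :
    ∃ μ : ℝ, ∀ W g ω, IsOpen W → IsMetricOn n W g → IsFormOn n k W ω →
      ∀ x ∈ W, ∀ a b, T.T W g ω x a b = μ * energyTensor n k g ω x a b := by
  obtain ⟨k, rfl⟩ : ∃ m, k = m + 1 := ⟨k - 1, by omega⟩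
  obtain ⟨μ, hμ⟩ := exists_val_eq (Nat.le_of_succ_le_succ hk2) scale
    fun i j r hij hi hj x b => by
      have h := divcond Set.univ _ _ isOpen_univ (isMetricOn_minkM n _) (isFormOn_linForm i j r)
        (fun x _ u => dext_linForm i j r x u) (fun x _ v => codiff_linForm hij hi hj x v)
        x (Set.mem_univ x) b
      rwa [show T.T Set.univ (fun _ => minkM n) (linForm n i j r) =
        fun y => T.val (linForm n i j r y) from funext fun y => funext fun a => funext fun b =>
          NaturalTensor.apply_minkM scale vanish hk1 (isFormOn_linForm i j r) y a b] at h
  exact ⟨μ, fun W g ω hW hg hω x hx a b =>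
    NaturalTensor.eq_mul_energyTensor scale vanish hμ hW hg hω hx a b⟩

end Paper
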